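/- arXiv:2209.09299 — 3 statements merged into one kernel-verified Lean document; each statement's English description precedes it below -/
import Mathlib

section
/- For any δ > 0 there exists a constant γ_δ > 0 such that, for the constrained candidate set built under the size constraint |τ| ≤ |τ₀|, the probability that the true model is not included satisfies ℙ_{(𝒰^d,Y)}(τ₀ ∉ S^(d)) ≤ {1 − γ_δ^{n−1}/(n−1)}^d + δ; consequently, as d → ∞, ℙ_{(𝒰^d,Y)}(τ₀ ∉ S^(d)) is eventually at most δ. -/
open MeasureTheory ProbabilityTheory Matrix Filter
open scoped ENNReal Classical

noncomputable section

namespace ReproSamples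

/-- Squared Euclidean norm of a vector in `ℝⁿ`. -/
def sqnorm {n : ℕ} (v : Fin n → ℝ) : ℝ := ∑ i, (v i) ^ 2

/-- The vector `β` with all coordinates outside `τ` set to `0`; this encodes the
vector `β_τ ∈ ℝ^{|τ|}`, so that `X_τ β_τ = X.mulVec (maskOn τ β)`. -/
def maskOn {p : ℕ} (τ : Finset (Fin p)) (β : Fin p → ℝ) : Fin p → ℝ :=
  fun j => if j ∈ τ then β j else 0

/-- The submatrix `X_τ` of the columns of `X` indexed by `τ`. -/
def subcols {n p : ℕ} (X : Matrix (Fin n) (Fin p) ℝ) (τ : Finset (Fin p)) :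
    Matrix (Fin n) {j // j ∈ τ} ℝ :=
  Matrix.of fun i j => X i j.1

/-- The matrix `M (MᵀM)⁻¹ Mᵀ` (orthogonal projection onto the column span of `M`
when `MᵀM` is invertible). -/
def projMat {n : ℕ} {m : Type} [Fintype m] [DecidableEq m]
    (M : Matrix (Fin n) m ℝ) : Matrix (Fin n) (Fin n) ℝ :=
  M * (Mᵀ * M)⁻¹ * Mᵀ

/-- The projection matrix `H_τ = X_τ (X_τᵀ X_τ)⁻¹ X_τᵀ`. -/
def proj {n p : ℕ} (X : Matrix (Fin n) (Fin p) ℝ) (τ : Finset (Fin p)) :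
    Matrix (Fin n) (Fin n) ℝ :=
  projMat (subcols X τ)

/-- Identifiability: `τ₀` is the unique minimizer of `|τ|` over
`{τ : X_τ β_τ = X_{τ₀} β₀ for some β_τ}` (here `β₀` is supported on `τ₀`). -/
def Identifiable {n p : ℕ} (X : Matrix (Fin n) (Fin p) ℝ) (τ₀ : Finset (Fin p))
    (β₀ : Fin p → ℝ) : Prop :=
  ∀ τ : Finset (Fin p), (∃ β : Fin p → ℝ, X.mulVec (maskOn τ β) = X.mulVec β₀) →
    τ ≠ τ₀ → τ₀.card < τ.card

/-- The separation constant `C_min`. -/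
def Cmin {n p : ℕ} (X : Matrix (Fin n) (Fin p) ℝ) (τ₀ : Finset (Fin p))
    (β₀ : Fin p → ℝ) : ℝ :=
  sInf ((fun τ : Finset (Fin p) =>
      sqnorm ((1 - proj X τ).mulVec (X.mulVec β₀)) /
        ((n * max (τ₀ \ τ).card 1 : ℕ) : ℝ)) ''
    {τ : Finset (Fin p) | τ ≠ τ₀ ∧ τ.card ≤ τ₀.card})

/-- Penalized objective `min_{β_τ, σ} ‖y − X_τ β_τ − σ u*‖² + λ|τ|`. -/
def objPen {n p : ℕ} (X : Matrix (Fin n) (Fin p) ℝ) (lam : ℝ) (y ustar : Fin n → ℝ)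
    (τ : Finset (Fin p)) : ℝ :=
  (⨅ bs : (Fin p → ℝ) × ℝ, sqnorm (y - X.mulVec (maskOn τ bs.1) - bs.2 • ustar)) +
    lam * τ.card

/-- Un-penalized objective `min_{β_τ, σ} ‖y − X_τ β_τ − σ u*‖²`. -/
def objFit {n p : ℕ} (X : Matrix (Fin n) (Fin p) ℝ) (y ustar : Fin n → ℝ)
    (τ : Finset (Fin p)) : ℝ :=
  ⨅ bs : (Fin p → ℝ) × ℝ, sqnorm (y - X.mulVec (maskOn τ bs.1) - bs.2 • ustar)

/-- Standard Gaussian measure `N(0, I_n)` on `ℝⁿ`. -/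
def stdGaussian (n : ℕ) : Measure (Fin n → ℝ) :=
  Measure.pi fun _ => gaussianReal 0 1

/-- Joint law of `(U, (U*_1, …, U*_d))`, all i.i.d. `N(0, I_n)`. -/
def jointMeasure (n d : ℕ) : Measure ((Fin n → ℝ) × (Fin d → Fin n → ℝ)) :=
  (stdGaussian n).prod (Measure.pi fun _ : Fin d => stdGaussian n)

/-- Squared cosine of the angle between two vectors. -/
def rho {n : ℕ} (v w : Fin n → ℝ) : ℝ := (v ⬝ᵥ w) ^ 2 / (sqnorm v * sqnorm w)

/-- `ρ_{τ⊥}(v, w) = ρ((I−H_τ)v, (I−H_τ)w)`. -/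
def rhoPerp {n p : ℕ} (X : Matrix (Fin n) (Fin p) ℝ) (τ : Finset (Fin p))
    (v w : Fin n → ℝ) : ℝ :=
  rho ((1 - proj X τ).mulVec v) ((1 - proj X τ).mulVec w)

/-- `ρ(v, τ) = ‖H_τ v‖²/‖v‖²`. -/
def rhoTau {n p : ℕ} (X : Matrix (Fin n) (Fin p) ℝ) (v : Fin n → ℝ)
    (τ : Finset (Fin p)) : ℝ :=
  sqnorm ((proj X τ).mulVec v) / sqnorm v

/-- The augmented matrix `(X_τ, u)`. -/
def augcols {n p : ℕ} (X : Matrix (Fin n) (Fin p) ℝ) (τ : Finset (Fin p))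
    (u : Fin n → ℝ) : Matrix (Fin n) ({j // j ∈ τ} ⊕ Unit) ℝ :=
  Matrix.of fun i j => Sum.elim (fun k : {j // j ∈ τ} => X i k.1) (fun _ => u i) j

/-- The projection matrix `H_{τ,u}` onto the column span of `(X_τ, u)`. -/
def projAug {n p : ℕ} (X : Matrix (Fin n) (Fin p) ℝ) (τ : Finset (Fin p))
    (u : Fin n → ℝ) : Matrix (Fin n) (Fin n) ℝ :=
  projMat (augcols X τ u)

/-- `γ²_{(u, τ₀)} = 1 − min_{|τ| < |τ₀|} ‖(I−H_{τ,u})X_{τ₀}β₀‖²/‖(I−H_τ)X_{τ₀}β₀‖²`. -/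
def gammaSq {n p : ℕ} (X : Matrix (Fin n) (Fin p) ℝ) (τ₀ : Finset (Fin p))
    (β₀ : Fin p → ℝ) (u : Fin n → ℝ) : ℝ :=
  1 - sInf ((fun τ : Finset (Fin p) =>
      sqnorm ((1 - projAug X τ u).mulVec (X.mulVec β₀)) /
        sqnorm ((1 - proj X τ).mulVec (X.mulVec β₀))) ''
    {τ : Finset (Fin p) | τ.card < τ₀.card})

/-- Residual sum of squares `min_β ‖y − X_τ β‖²`. -/
def rss {n p : ℕ} (X : Matrix (Fin n) (Fin p) ℝ) (y : Fin n → ℝ)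
    (τ : Finset (Fin p)) : ℝ :=
  ⨅ β : Fin p → ℝ, sqnorm (y - X.mulVec (maskOn τ β))

/-- `Y*_w = a + b (I−H_τ)u / ‖(I−H_τ)u‖`. -/
def ystar {n p : ℕ} (X : Matrix (Fin n) (Fin p) ℝ) (τ : Finset (Fin p))
    (a : Fin n → ℝ) (b : ℝ) (u : Fin n → ℝ) : Fin n → ℝ :=
  a + (b / Real.sqrt (sqnorm ((1 - proj X τ).mulVec u))) • ((1 - proj X τ).mulVec u)

/-- `p_{(w,τ)}(τ') = ℙ(T̃(Y*_w, τ) = τ')`. -/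
def pfun {n p : ℕ} (X : Matrix (Fin n) (Fin p) ℝ)
    (Tt : (Fin n → ℝ) → Finset (Fin p) → Finset (Fin p))
    (τ : Finset (Fin p)) (a : Fin n → ℝ) (b : ℝ) (τ' : Finset (Fin p)) : ℝ :=
  ((stdGaussian n) {u | Tt (ystar X τ a b u) τ = τ'}).toReal

/-- `B_α(τ, w) = {τ* : ∑_{τ' : p(τ') ≤ p(τ*)} p(τ') ≥ 1 − α}`. -/
def Bset {n p : ℕ} (X : Matrix (Fin n) (Fin p) ℝ)
    (Tt : (Fin n → ℝ) → Finset (Fin p) → Finset (Fin p)) (α : ℝ)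
    (τ : Finset (Fin p)) (a : Fin n → ℝ) (b : ℝ) : Set (Finset (Fin p)) :=
  {τstar | 1 - α ≤
    ∑ τ' ∈ Finset.univ.filter (fun τ' => pfun X Tt τ a b τ' ≤ pfun X Tt τ a b τstar),
      pfun X Tt τ a b τ'}

/-- `τ ∈ Γ̄^τ_α(y)`-membership test: `T̃(y,τ) ∈ B_α(τ, W̃(y,τ))` with
`W̃(y,τ) = (H_τ y, ‖(I−H_τ)y‖)`. -/
def inCS {n p : ℕ} (X : Matrix (Fin n) (Fin p) ℝ)
    (Tt : (Fin n → ℝ) → Finset (Fin p) → Finset (Fin p)) (α : ℝ)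
    (y : Fin n → ℝ) (τ : Finset (Fin p)) : Prop :=
  Tt y τ ∈ Bset X Tt α τ ((proj X τ).mulVec y)
    (Real.sqrt (sqnorm ((1 - proj X τ).mulVec y)))

/-- `O_{τ,Λ}`: orthogonal projection onto the column span of `(I−H_{τ∖Λ}) X_{Λ∩τ}`. -/
def projO {n p : ℕ} (X : Matrix (Fin n) (Fin p) ℝ) (τ Λ : Finset (Fin p)) :
    Matrix (Fin n) (Fin n) ℝ :=
  projMat ((1 - proj X (τ \ Λ)) * subcols X (Λ ∩ τ))

/-- The nuclear mapping `T̃(y, (β_Λ, τ))` with values in `EReal` (it takes the value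
`⊤ = +∞` when `β_i ≠ 0` for some `i ∈ Λ ∖ τ`). -/
def Tnuc {n p : ℕ} (X : Matrix (Fin n) (Fin p) ℝ) (Λ τ : Finset (Fin p))
    (β : Fin p → ℝ) (y : Fin n → ℝ) : EReal :=
  if ∃ i ∈ Λ \ τ, β i ≠ 0 then ⊤
  else if Λ ∩ τ = ∅ then 0
  else ((((y - X.mulVec (maskOn Λ β)) ⬝ᵥ (projO X τ Λ).mulVec (y - X.mulVec (maskOn Λ β))) /
    (((y - X.mulVec (maskOn Λ β)) ⬝ᵥ (1 - proj X τ).mulVec (y - X.mulVec (maskOn Λ β))) /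
      ((n : ℝ) - τ.card)) : ℝ) : EReal)

/-- The statistic `u ↦ (uᵀ O_{τ,Λ} u)/(uᵀ(I−H_τ)u/(n−|τ|))`. -/
def fstat {n p : ℕ} (X : Matrix (Fin n) (Fin p) ℝ) (τ Λ : Finset (Fin p))
    (u : Fin n → ℝ) : ℝ :=
  (u ⬝ᵥ (projO X τ Λ).mulVec u) / ((u ⬝ᵥ (1 - proj X τ).mulVec u) / ((n : ℝ) - τ.card))

/-- The `α`-quantile `q_α(τ, Λ)` of the law of `fstat` under `N(0, I_n)`. -/
def qant {n p : ℕ} (X : Matrix (Fin n) (Fin p) ℝ) (τ Λ : Finset (Fin p)) (α : ℝ) : ℝ :=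
  sInf {x : ℝ | α ≤ (((stdGaussian n).map (fstat X τ Λ)) (Set.Iic x)).toReal}



theorem pi_ac (μ ν : Measure ℝ) [IsProbabilityMeasure μ] [SigmaFinite ν] (h : μ ≪ ν) :
    ∀ n : ℕ, (Measure.pi fun _ : Fin n => μ) ≪ (Measure.pi fun _ : Fin n => ν) := by
  intro n
  induction n with
  | zero => 
    rw [Measure.pi_of_empty, Measure.pi_of_empty]
  | succ n ih =>
    have h1 := (measurePreserving_piFinSuccAbove (fun _ : Fin (n+1) => μ) 0).symm
    have h2 := (measurePreserving_piFinSuccAbove (fun _ : Fin (n+1) => ν) 0).symm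
    rw [← h1.map_eq, ← h2.map_eq]
    exact (h.prod ih).map h2.measurable

instance (n : ℕ) : IsProbabilityMeasure (stdGaussian n) := by
  unfold stdGaussian; infer_instance

instance (n : ℕ) : (stdGaussian n).IsOpenPosMeasure := by
  haveI : (gaussianReal 0 1).IsOpenPosMeasure :=
    (gaussianReal_absolutelyContinuous' 0 one_ne_zero).isOpenPosMeasure
  unfold stdGaussian; infer_instance

theorem gaussian_submodule {n : ℕ} (S : Submodule ℝ (Fin n → ℝ)) (hS : S ≠ ⊤) :
    stdGaussian n S = 0 := by
  have h := pi_ac _ _ (gaussianReal_absolutelyContinuous 0 one_ne_zero) n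
  rw [← volume_pi] at h
  exact h (Measure.addHaar_submodule _ S hS)

theorem cs_bound {n : ℕ} (h : (Fin n → ℝ) →ₗ[ℝ] ℝ) (r : Fin n → ℝ) :
    (h r) ^ 2 ≤ (∑ i, (h (Pi.single i 1)) ^ 2) * sqnorm r := by
  have : h r = ∑ i, h (Pi.single i 1) * r i := by
    conv_lhs => rw [pi_eq_sum_univ' r]
    simp [mul_comm, Pi.single_apply, Pi.single, Function.update_apply, eq_comm]
  rw [this]
  exact Finset.sum_mul_sq_le_sq_mul_sq _ _ _

/-- span of columns -/
def colspan {n p : ℕ} (X : Matrix (Fin n) (Fin p) ℝ) (τ : Finset (Fin p)) :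
    Submodule ℝ (Fin n → ℝ) :=
  Submodule.span ℝ ((τ.image fun j => Xᵀ j : Finset (Fin n → ℝ)) : Set (Fin n → ℝ))

theorem mulVec_mask_mem {n p : ℕ} (X : Matrix (Fin n) (Fin p) ℝ) (τ : Finset (Fin p))
    (β : Fin p → ℝ) : X.mulVec (maskOn τ β) ∈ colspan X τ := by
  have : X.mulVec (maskOn τ β) = ∑ j, maskOn τ β j • Xᵀ j := by
    ext i
    simp [mulVec, dotProduct, mul_comm]
  rw [this]
  refine Submodule.sum_mem _ fun j _ => ?_
  by_cases hj : j ∈ τ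
  · exact Submodule.smul_mem _ _ (Submodule.subset_span (by
      simpa using ⟨j, hj, rfl⟩))
  · simp [maskOn, hj]

theorem mem_colspan {n p : ℕ} (X : Matrix (Fin n) (Fin p) ℝ) (τ : Finset (Fin p))
    (v : Fin n → ℝ) (hv : v ∈ colspan X τ) : ∃ β : Fin p → ℝ, X.mulVec (maskOn τ β) = v := by
  unfold colspan at hv
  induction hv using Submodule.span_induction with
  | mem x hx =>
    simp only [Finset.coe_image, Set.mem_image, Finset.mem_coe] at hx
    obtain ⟨j, hj, rfl⟩ := hx
    refine ⟨Pi.single j 1, ?_⟩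
    have : maskOn τ (Pi.single j 1) = Pi.single j 1 := by
      ext k
      by_cases hk : k = j
      · subst hk; simp [maskOn, hj]
      · simp [maskOn, hk]
    rw [this]
    ext i; simp
  | zero => exact ⟨0, by
      have : maskOn τ (0 : Fin p → ℝ) = 0 := by ext; simp [maskOn]
      simp [this]⟩
  | add x y _ _ hx hy =>
    obtain ⟨a, rfl⟩ := hx
    obtain ⟨b, rfl⟩ := hy
    refine ⟨a + b, ?_⟩
    rw [← Matrix.mulVec_add]
    congr 1; ext k; simp only [maskOn, Pi.add_apply]; split_ifs <;> simp
  | smul c x _ hx =>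
    obtain ⟨a, rfl⟩ := hx
    refine ⟨c • a, ?_⟩
    rw [← Matrix.mulVec_smul]
    congr 1; ext k; simp only [maskOn, Pi.smul_apply]; split_ifs <;> simp

/-- the exceptional subspace -/
def exc {n p : ℕ} (X : Matrix (Fin n) (Fin p) ℝ) (τ : Finset (Fin p)) (m : Fin n → ℝ) :
    Submodule ℝ (Fin n → ℝ) :=
  Submodule.span ℝ ((insert m (τ.image fun j => Xᵀ j) : Finset (Fin n → ℝ)) : Set (Fin n → ℝ))

theorem exc_ne_top {n p : ℕ} (X : Matrix (Fin n) (Fin p) ℝ) (τ : Finset (Fin p))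
    (m : Fin n → ℝ) (h : τ.card + 1 < n) : exc X τ m ≠ ⊤ := by
  intro ht
  have h1 := finrank_span_finset_le_card (R := ℝ)
    (insert m (τ.image fun j => Xᵀ j) : Finset (Fin n → ℝ))
  have h2 : Module.finrank ℝ (exc X τ m) = n := by rw [ht, finrank_top]; simp
  have h3 := Finset.card_insert_le m (τ.image fun j => Xᵀ j)
  have h4 := Finset.card_image_le (s := τ) (f := fun j => Xᵀ j)
  unfold exc at h2
  rw [Set.finrank] at h1
  omega

theorem sqnorm_nonneg {n : ℕ} (v : Fin n → ℝ) : 0 ≤ sqnorm v :=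
  Finset.sum_nonneg fun _ _ => sq_nonneg _

theorem objFit_le {n p : ℕ} (X : Matrix (Fin n) (Fin p) ℝ) (y w : Fin n → ℝ)
    (τ : Finset (Fin p)) (β : Fin p → ℝ) (σ : ℝ) :
    objFit X y w τ ≤ sqnorm (y - X.mulVec (maskOn τ β) - σ • w) :=
  ciInf_le (f := fun bs : (Fin p → ℝ) × ℝ => sqnorm (y - X.mulVec (maskOn τ bs.1) - bs.2 • w))
    ⟨0, by rintro _ ⟨_, rfl⟩; exact sqnorm_nonneg _⟩ (β, σ)

theorem key {n p : ℕ} (X : Matrix (Fin n) (Fin p) ℝ) (τ₀ : Finset (Fin p)) (β₀ : Fin p → ℝ)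
    (hβsupp : ∀ j ∉ τ₀, β₀ j = 0) (σ₀ : ℝ) (τ : Finset (Fin p))
    (hm : X.mulVec β₀ ∉ colspan X τ) (u : Fin n → ℝ) (hu : u ∉ exc X τ (X.mulVec β₀)) :
    ∀ᶠ z : (Fin n → ℝ) × (Fin n → ℝ) in nhds (u, u),
      objFit X (X.mulVec β₀ + σ₀ • z.1) z.2 τ₀ < objFit X (X.mulVec β₀ + σ₀ • z.1) z.2 τ := by
  set m := X.mulVec β₀ with hmdef
  obtain ⟨φ, hφ, hφ0⟩ := Submodule.exists_le_ker_of_notMem hm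
  obtain ⟨ψ, hψ, hψ0⟩ := Submodule.exists_le_ker_of_notMem hu
  have hφc : Continuous φ := φ.continuous_of_finiteDimensional
  have hψc : Continuous ψ := ψ.continuous_of_finiteDimensional
  have hψm : ψ m = 0 := hψ0 (Submodule.subset_span (by simp))
  have hψL : colspan X τ ≤ LinearMap.ker ψ :=
    le_trans (Submodule.span_mono (by simp)) hψ0
  let h : (Fin n → ℝ) → (Fin n → ℝ) →ₗ[ℝ] ℝ := fun w => ψ w • φ - φ w • ψ
  have hev : ∀ᶠ z : (Fin n → ℝ) × (Fin n → ℝ) in nhds (u, u),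
      (∑ i, (h z.2 (Pi.single i 1)) ^ 2) * sqnorm (σ₀ • z.1 - σ₀ • z.2)
        < (h z.2 (m + σ₀ • z.1)) ^ 2 := by
    refine ContinuousAt.eventually_lt (Continuous.continuousAt ?_) (Continuous.continuousAt ?_) ?_
    · simp only [h, sqnorm, LinearMap.sub_apply, LinearMap.smul_apply]
      fun_prop
    · simp only [h, LinearMap.sub_apply, LinearMap.smul_apply]
      fun_prop
    · have : h u (m + σ₀ • u) = ψ u * φ m := by
        simp [h, hψm]; ring
      simp only [this, sub_self]
      have : ψ u * φ m ≠ 0 := mul_ne_zero hψ hφ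
      simp [sqnorm]
      positivity
  filter_upwards [hev] with z hz
  have hmask : maskOn τ₀ β₀ = β₀ := by
    ext j; by_cases hj : j ∈ τ₀ <;> simp [maskOn, hj, hβsupp]
  have h1 : objFit X (m + σ₀ • z.1) z.2 τ₀ ≤ sqnorm (σ₀ • z.1 - σ₀ • z.2) := by
    have := objFit_le X (m + σ₀ • z.1) z.2 τ₀ β₀ σ₀
    rw [hmask, ← hmdef] at this
    convert this using 2
    abel
  set K := ∑ i, (h z.2 (Pi.single i 1)) ^ 2 with hK
  have hK0 : 0 ≤ K := Finset.sum_nonneg fun _ _ => sq_nonneg _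
  have hKpos : 0 < K := by
    rcases hK0.eq_or_lt with h0 | h0
    · have := cs_bound (h z.2) (m + σ₀ • z.1)
      rw [← hK, ← h0] at this
      rw [← h0] at hz
      linarith
    · exact h0
  have h2 : (h z.2 (m + σ₀ • z.1)) ^ 2 / K ≤ objFit X (m + σ₀ • z.1) z.2 τ := by
    refine le_ciInf fun bs => ?_
    rw [div_le_iff₀ hKpos, mul_comm]
    have := cs_bound (h z.2) (m + σ₀ • z.1 - X.mulVec (maskOn τ bs.1) - bs.2 • z.2)
    have e1 : φ (X.mulVec (maskOn τ bs.1)) = 0 := hφ0 (mulVec_mask_mem X τ _)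
    have e2 : ψ (X.mulVec (maskOn τ bs.1)) = 0 := hψL (mulVec_mask_mem X τ _)
    have e3 : h z.2 (m + σ₀ • z.1 - X.mulVec (maskOn τ bs.1) - bs.2 • z.2)
        = h z.2 (m + σ₀ • z.1) := by
      simp [h, e1, e2]; ring
    rwa [e3] at this
  refine lt_of_le_of_lt h1 (lt_of_lt_of_le ?_ h2)
  rw [lt_div_iff₀ hKpos, mul_comm]
  exact hz

theorem prob_part {n : ℕ} (W : Set ((Fin n → ℝ) × (Fin n → ℝ))) (hW : IsOpen W)
    (hae : ∀ᵐ u ∂(stdGaussian n), (u, u) ∈ W) (δ : ℝ) (hδ : 0 < δ) :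
    ∃ c : ℝ, 0 < c ∧ c < 1 ∧ ∀ d : ℕ,
      jointMeasure n d {ω | ∀ b : Fin d, (ω.1, ω.2 b) ∉ W} ≤
        ENNReal.ofReal ((1 - c) ^ d + δ) := by
  set μ := stdGaussian n with hμ
  let g : (Fin n → ℝ) → ℝ≥0∞ := fun u => μ (Prod.mk u ⁻¹' W)
  have hg : Measurable g := measurable_measure_prodMk_left hW.measurableSet
  have hgpos : ∀ᵐ u ∂μ, 0 < g u := by
    filter_upwards [hae] with u hu
    exact (hW.preimage (by fun_prop : Continuous (Prod.mk u))).measure_pos μ ⟨u, hu⟩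
  let s : ℕ → Set (Fin n → ℝ) := fun k => {u | g u < ENNReal.ofReal (1 / ((k : ℝ) + 2))}
  have hsm : ∀ k, MeasurableSet (s k) := fun k => measurableSet_lt hg measurable_const
  have hlim : Tendsto (fun k => μ (s k)) atTop (nhds (μ (⋂ k, s k))) := by
    refine tendsto_measure_iInter_atTop (fun k => (hsm k).nullMeasurableSet) ?_
      ⟨0, measure_ne_top _ _⟩
    intro i j hij u hu
    simp only [s, Set.mem_setOf_eq] at hu ⊢
    refine lt_of_lt_of_le hu (ENNReal.ofReal_le_ofReal ?_)
    have : (i : ℝ) ≤ j := by exact_mod_cast hij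
    gcongr
  have h0 : μ (⋂ k, s k) = 0 := by
    refine measure_mono_null ?_ hgpos
    intro u hu
    simp only [Set.mem_compl_iff, Set.mem_setOf_eq, not_lt, nonpos_iff_eq_zero]
    have ht : Tendsto (fun k : ℕ => ENNReal.ofReal (1 / ((k : ℝ) + 2))) atTop (nhds 0) := by
      rw [← ENNReal.ofReal_zero]
      refine ENNReal.tendsto_ofReal ?_
      refine tendsto_const_nhds.div_atTop ?_
      exact tendsto_atTop_add_const_right _ _ tendsto_natCast_atTop_atTop
    refine le_antisymm (ge_of_tendsto' ht fun k => ?_) bot_le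
    exact (Set.mem_iInter.1 hu k).le
  rw [h0] at hlim
  obtain ⟨k, hk⟩ := (hlim.eventually_lt_const (ENNReal.ofReal_pos.2 hδ)).exists
  have hcpos : 0 < 1 / ((k : ℝ) + 2) := by positivity
  have hclt : 1 / ((k : ℝ) + 2) < 1 := by
    rw [div_lt_one (by positivity)]
    have : (0 : ℝ) ≤ k := by positivity
    linarith
  refine ⟨1 / ((k : ℝ) + 2), hcpos, hclt, fun d => ?_⟩
  set c := 1 / ((k : ℝ) + 2) with hc
  have hB : MeasurableSet {ω : (Fin n → ℝ) × (Fin d → Fin n → ℝ) |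
      ∀ b : Fin d, (ω.1, ω.2 b) ∉ W} := by
    rw [Set.setOf_forall]
    refine MeasurableSet.iInter fun b => ?_
    exact (hW.measurableSet.preimage (by fun_prop :
      Measurable fun ω : (Fin n → ℝ) × (Fin d → Fin n → ℝ) => (ω.1, ω.2 b))).compl
  rw [jointMeasure, Measure.prod_apply hB]
  calc ∫⁻ u, (Measure.pi fun _ : Fin d => stdGaussian n) (Prod.mk u ⁻¹'
          {ω : (Fin n → ℝ) × (Fin d → Fin n → ℝ) | ∀ b : Fin d, (ω.1, ω.2 b) ∉ W}) ∂(stdGaussian n)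
      = ∫⁻ u, (1 - g u) ^ d ∂μ := by
        refine lintegral_congr fun u => ?_
        have : Prod.mk u ⁻¹' {ω : (Fin n → ℝ) × (Fin d → Fin n → ℝ) |
            ∀ b : Fin d, (ω.1, ω.2 b) ∉ W} = Set.univ.pi fun _ => (Prod.mk u ⁻¹' W)ᶜ := by
          ext; simp
        rw [this, Measure.pi_pi, Finset.prod_const, Finset.card_univ, Fintype.card_fin,
          prob_compl_eq_one_sub (hW.measurableSet.preimage (by fun_prop))]
    _ ≤ ∫⁻ u, (ENNReal.ofReal ((1 - c) ^ d) + (s k).indicator 1 u) ∂μ := by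
        refine lintegral_mono fun u => ?_
        by_cases hu : u ∈ s k
        · simp only [Set.indicator_of_mem hu, Pi.one_apply]
          exact le_trans (pow_le_one' tsub_le_self d) le_add_self
        · simp only [Set.indicator_of_notMem hu, add_zero]
          rw [ENNReal.ofReal_pow (by linarith), ENNReal.ofReal_sub _ hcpos.le, ENNReal.ofReal_one]
          have : ENNReal.ofReal c ≤ g u := not_lt.1 hu
          gcongr
    _ = ENNReal.ofReal ((1 - c) ^ d) + μ (s k) := by
        rw [lintegral_add_left measurable_const, lintegral_const, measure_univ, mul_one,
          lintegral_indicator_one (hsm k)]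
    _ ≤ ENNReal.ofReal ((1 - c) ^ d + δ) := by
        rw [ENNReal.ofReal_add (pow_nonneg (by linarith) _) hδ.le]
        gcongr

/-- **Theorem A.1.** Finite-`n` bound for the constrained (size `≤ |τ₀|`)
repro-samples candidate set: for any `δ > 0` there is `γ_δ > 0` with
`ℙ(τ₀ ∉ S^(d)) ≤ (1 − γ_δ^{n−1}/(n−1))^d + δ`; consequently, as `d → ∞`
the non-coverage probability is eventually at most (any number above) `δ`. -/
theorem constrained_candidate_set_finite_sample {n p : ℕ}
    (X : Matrix (Fin n) (Fin p) ℝ) (τ₀ : Finset (Fin p)) (β₀ : Fin p → ℝ)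
    (hβsupp : ∀ j ∉ τ₀, β₀ j = 0) (hβne : ∀ j ∈ τ₀, β₀ j ≠ 0)
    (σ₀ : ℝ) (hσ₀ : 0 < σ₀)
    (hGram : ∀ τ : Finset (Fin p), τ.card ≤ τ₀.card →
      IsUnit ((subcols X τ)ᵀ * subcols X τ).det)
    (hid : Identifiable X τ₀ β₀)
    (hn : τ₀.card + 4 < n)
    -- `tauHat y ustar` is a (measurable choice of) minimizer of
    -- `min_{β_τ,σ} ‖y − X_τ β_τ − σ u*‖²` over models `τ` with `|τ| ≤ |τ₀|`:
    (tauHat : (Fin n → ℝ) → (Fin n → ℝ) → Finset (Fin p))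
    (hcard : ∀ y ustar : Fin n → ℝ, (tauHat y ustar).card ≤ τ₀.card)
    (hmin : ∀ (y ustar : Fin n → ℝ) (τ : Finset (Fin p)), τ.card ≤ τ₀.card →
      objFit X y ustar (tauHat y ustar) ≤ objFit X y ustar τ)
    (δ : ℝ) (hδ : 0 < δ) :
    ∃ γδ : ℝ, 0 < γδ ∧
      (∀ d : ℕ,
        jointMeasure n d
            {ω | ∀ b : Fin d, tauHat (X.mulVec β₀ + σ₀ • ω.1) (ω.2 b) ≠ τ₀} ≤
          ENNReal.ofReal ((1 - γδ ^ (n - 1) / ((n : ℝ) - 1)) ^ d + δ)) ∧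
      Filter.limsup (fun d : ℕ =>
          jointMeasure n d
            {ω | ∀ b : Fin d, tauHat (X.mulVec β₀ + σ₀ • ω.1) (ω.2 b) ≠ τ₀})
        Filter.atTop ≤ ENNReal.ofReal δ := by
  classical
  let W0 : Set ((Fin n → ℝ) × (Fin n → ℝ)) := {z | ∀ τ : Finset (Fin p), τ ≠ τ₀ →
    τ.card ≤ τ₀.card →
      objFit X (X.mulVec β₀ + σ₀ • z.1) z.2 τ₀ < objFit X (X.mulVec β₀ + σ₀ • z.1) z.2 τ}
  have hae : ∀ᵐ u ∂(stdGaussian n), (u, u) ∈ interior W0 := by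
    have h1 : ∀ᵐ u ∂(stdGaussian n), ∀ τ : Finset (Fin p), τ.card ≤ τ₀.card →
        u ∉ exc X τ (X.mulVec β₀) := by
      rw [ae_all_iff]
      intro τ
      by_cases hτ : τ.card ≤ τ₀.card
      · have := gaussian_submodule (exc X τ (X.mulVec β₀)) (exc_ne_top X τ _ (by omega))
        filter_upwards [measure_eq_zero_iff_ae_notMem.1 this] with u hu _ using hu
      · exact Eventually.of_forall fun u h => absurd h hτ
    filter_upwards [h1] with u hu
    rw [mem_interior_iff_mem_nhds]
    change ∀ᶠ z in nhds (u, u), z ∈ W0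
    simp only [W0, Set.mem_setOf_eq]
    rw [eventually_all]
    intro τ
    by_cases hne : τ = τ₀
    · exact Eventually.of_forall fun z h => absurd hne h
    by_cases hτ : τ.card ≤ τ₀.card
    · have hm : X.mulVec β₀ ∉ colspan X τ := fun hmem =>
        absurd (hid τ (mem_colspan X τ _ hmem) hne) (not_lt.2 hτ)
      filter_upwards [key X τ₀ β₀ hβsupp σ₀ τ hm u (hu τ hτ)] with z hz _ _ using hz
    · exact Eventually.of_forall fun z _ h => absurd h hτ
  obtain ⟨c, hc0, hc1, hc⟩ := prob_part (interior W0) isOpen_interior hae δ hδ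
  have hbound : ∀ d : ℕ, jointMeasure n d
      {ω | ∀ b : Fin d, tauHat (X.mulVec β₀ + σ₀ • ω.1) (ω.2 b) ≠ τ₀} ≤
        ENNReal.ofReal ((1 - c) ^ d + δ) := by
    intro d
    refine le_trans (measure_mono ?_) (hc d)
    intro ω hω b hb
    have h2 := interior_subset hb
    have := h2 _ (hω b) (hcard _ _)
    exact absurd (hmin _ _ τ₀ le_rfl) (not_le.2 this)
  have hn1 : (0 : ℝ) < (n : ℝ) - 1 := by
    have : (4 : ℝ) < n := by exact_mod_cast (by omega : 4 < n)
    linarith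
  have hγ : ((c * ((n : ℝ) - 1)) ^ (((n - 1 : ℕ) : ℝ)⁻¹)) ^ (n - 1) / ((n : ℝ) - 1) = c := by
    rw [Real.rpow_inv_natCast_pow (by positivity) (by omega)]
    field_simp
  refine ⟨(c * ((n : ℝ) - 1)) ^ (((n - 1 : ℕ) : ℝ)⁻¹), by positivity, ?_, ?_⟩
  · rw [hγ]; exact hbound
  · have ht : Tendsto (fun d : ℕ => ENNReal.ofReal ((1 - c) ^ d + δ)) atTop
        (nhds (ENNReal.ofReal δ)) := by
      refine ENNReal.tendsto_ofReal ?_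
      simpa using (tendsto_pow_atTop_nhds_zero_of_lt_one (by linarith : 0 ≤ 1 - c)
        (by linarith)).add_const δ
    rw [← ht.limsup_eq]
    exact limsup_le_limsup (Eventually.of_forall hbound)

end ReproSamples
end
end

section
/- For the constrained candidate set built under the size constraint |τ| ≤ |τ₀| and any finite number d of repro samples, the probability that the true model is not included satisfies ℙ_{(𝒰^d,Y)}(τ₀ ∉ S^(d)) ≤ 6·exp[−(n/(18σ₀²))·{0.3·C_min − 36·(log p / n)·σ₀²}] + exp{−n·d·(0.23 − (|τ₀|·log p + 2)/n)}. Consequently, if |τ₀|·log p / n < 0.23 and C_min > 120·(log(p+1)/n)·σ₀² for n large enough, then ℙ_{(𝒰^d,Y)}(τ₀ ∉ S^(d)) → 0 as n → ∞ for any fixed d. -/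
open MeasureTheory ProbabilityTheory Matrix Filter
open scoped ENNReal Classical

noncomputable section

namespace ReproSamples

abbrev EE (n : ℕ) := EuclideanSpace ℝ (Fin n)

lemma integral_exp_sq (c : ℝ) (hc : c < 1 / 2) :
    ∫ x, Real.exp (c * x ^ 2) ∂(gaussianReal 0 1) = (Real.sqrt (1 - 2 * c))⁻¹ := by
  rw [integral_gaussianReal_eq_integral_smul (by norm_num)]
  have h : ∀ x : ℝ, gaussianPDFReal 0 1 x • Real.exp (c * x ^ 2)
      = (Real.sqrt (2 * Real.pi))⁻¹ * Real.exp (-(1 / 2 - c) * x ^ 2) := by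
    intro x
    simp only [gaussianPDFReal_def, smul_eq_mul, mul_assoc, NNReal.coe_one, mul_one]
    rw [← Real.exp_add]
    congr 2
    ring
  simp_rw [h]
  rw [integral_const_mul, integral_gaussian, ← Real.sqrt_inv, ← Real.sqrt_inv,
    ← Real.sqrt_mul (by positivity)]
  congr 1
  have : (1 / 2 - c) ≠ 0 := by linarith
  have : (1 - 2 * c) ≠ 0 := by linarith
  have := Real.pi_ne_zero
  field_simp

lemma integrable_exp_sq (c : ℝ) (hc : c < 1 / 2) :
    Integrable (fun x => Real.exp (c * x ^ 2)) (gaussianReal 0 1) := by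
  by_contra h
  have h1 := integral_exp_sq c hc
  rw [integral_undef h] at h1
  have : 0 < (Real.sqrt (1 - 2 * c))⁻¹ := by
    have : 0 < 1 - 2 * c := by linarith
    positivity
  linarith

lemma law_ortho {n : ℕ} {ι : Type} [Fintype ι] (v : ι → EE n) (hv : Orthonormal ℝ v) :
    (ProbabilityTheory.stdGaussian (EE n)).map (fun u => fun i => inner ℝ (v i) u)
      = Measure.pi (fun _ : ι => gaussianReal 0 1) := by
  have hm : Measurable (fun u : EE n => fun i => inner ℝ (v i) u) := by fun_prop
  have key : (ProbabilityTheory.stdGaussian (EE n)).map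
      (fun u => WithLp.toLp 2 (fun i => inner ℝ (v i) u))
      = ProbabilityTheory.stdGaussian (EuclideanSpace ℝ ι) := by
    apply Measure.ext_of_charFun
    ext t
    rw [charFun_stdGaussian, charFun_apply, integral_map (by fun_prop) (by fun_prop)]
    have : ∀ u : EE n, inner ℝ (WithLp.toLp 2 (fun i => inner ℝ (v i) u)) t
        = inner ℝ u (∑ i, t i • v i) := by
      intro u
      rw [PiLp.inner_apply, inner_sum]
      apply Finset.sum_congr rfl
      intro i _
      rw [inner_smul_right, real_inner_comm (v i) u]
      simp
    simp_rw [this]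
    rw [← charFun_apply, charFun_stdGaussian]
    have : ‖∑ i, t i • v i‖ ^ 2 = ‖t‖ ^ 2 := by
      rw [← real_inner_self_eq_norm_sq, hv.inner_sum, EuclideanSpace.real_norm_sq_eq]
      simp [sq]
    congr 1
    rw [← Complex.ofReal_pow, this]
    simp
  rw [← map_pi_eq_stdGaussian (ι := ι)] at key
  have h2 := congrArg (fun m => m.map (WithLp.ofLp (p := 2) (V := ι → ℝ))) key
  simp only at h2
  rw [Measure.map_map (by fun_prop) (by fun_prop), Measure.map_map (by fun_prop) (by fun_prop)] at h2
  have h3 : (WithLp.ofLp (p := 2) (V := ι → ℝ)) ∘ (WithLp.toLp 2) = id := rfl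
  rw [h3, Measure.map_id] at h2
  exact h2

lemma chernoff_sq {n : ℕ} {ι : Type} [Fintype ι] (v : ι → EE n) (hv : Orthonormal ℝ v)
    (c : ι → ℝ) (hc : ∀ i, c i < 1 / 2) (K : ℝ) :
    ProbabilityTheory.stdGaussian (EE n) {u | K ≤ ∑ i, c i * (inner ℝ (v i) u) ^ 2} ≤
      ENNReal.ofReal (Real.exp (-K) * ∏ i, (Real.sqrt (1 - 2 * c i))⁻¹) := by
  have hm : Measurable (fun u : EE n => fun i => inner ℝ (v i) u) := by fun_prop
  have hS : MeasurableSet {x : ι → ℝ | K ≤ ∑ i, c i * (x i) ^ 2} :=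
    measurableSet_le measurable_const (by fun_prop)
  have h1 : ProbabilityTheory.stdGaussian (EE n) {u | K ≤ ∑ i, c i * (inner ℝ (v i) u) ^ 2}
      = Measure.pi (fun _ : ι => gaussianReal 0 1) {x : ι → ℝ | K ≤ ∑ i, c i * (x i) ^ 2} := by
    rw [← law_ortho v hv, Measure.map_apply hm hS]
    rfl
  rw [h1]
  have hexp : ∀ x : ι → ℝ, Real.exp (1 * ∑ i, c i * (x i) ^ 2) = ∏ i, Real.exp (c i * (x i) ^ 2) := by
    intro x
    rw [one_mul, Real.exp_sum]
  have h2 := measure_ge_le_exp_mul_mgf (μ := Measure.pi (fun _ : ι => gaussianReal 0 1))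
    (X := fun x => ∑ i, c i * (x i) ^ 2) (t := 1) K (by norm_num) (by
      simp_rw [hexp]
      exact Integrable.fintype_prod (f := fun i x => Real.exp (c i * x ^ 2))
        (fun i => integrable_exp_sq _ (hc i)))
  rw [mgf] at h2
  simp_rw [hexp] at h2
  rw [integral_fintype_prod_eq_prod (f := fun i x => Real.exp (c i * x ^ 2))] at h2
  simp_rw [integral_exp_sq _ (hc _)] at h2
  rw [← ofReal_measureReal]
  apply ENNReal.ofReal_le_ofReal
  simpa using h2

lemma chernoff_lin {n : ℕ} (w : EE n) (K : ℝ) :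
    ProbabilityTheory.stdGaussian (EE n) {u | K ≤ inner ℝ w u} ≤
      ENNReal.ofReal (Real.exp (-K + ‖w‖ ^ 2 / 2)) := by
  have hmap : (ProbabilityTheory.stdGaussian (EE n)).map (fun u => inner ℝ w u)
      = gaussianReal 0 (‖w‖ ^ 2).toNNReal := by
    have := IsGaussian.map_eq_gaussianReal (μ := ProbabilityTheory.stdGaussian (EE n))
      (innerSL ℝ w)
    rw [variance_dual_stdGaussian, integral_strongDual_stdGaussian, innerSL_apply_norm] at this
    exact this
  have hS : MeasurableSet {x : ℝ | K ≤ x} := measurableSet_Ici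
  have h1 : ProbabilityTheory.stdGaussian (EE n) {u | K ≤ inner ℝ w u}
      = gaussianReal 0 (‖w‖ ^ 2).toNNReal {x : ℝ | K ≤ x} := by
    rw [← hmap, Measure.map_apply (by fun_prop) hS]
    rfl
  rw [h1, ← ofReal_measureReal]
  apply ENNReal.ofReal_le_ofReal
  have h2 := measure_ge_le_exp_mul_mgf (μ := gaussianReal 0 (‖w‖ ^ 2).toNNReal)
    (X := id) (t := 1) K (by norm_num) (integrable_exp_mul_gaussianReal 1)
  rw [mgf_gaussianReal (μ := 0) (v := (‖w‖ ^ 2).toNNReal) (by simp), ← Real.exp_add] at h2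
  rw [Real.coe_toNNReal _ (by positivity)] at h2
  simpa using h2

lemma sp_norm_sq {n : ℕ} (Q : Submodule ℝ (EE n)) (u : EE n) :
    ‖Q.starProjection u‖ ^ 2
      = ∑ i, (inner ℝ ((stdOrthonormalBasis ℝ Q i : Q) : EE n) u) ^ 2 := by
  rw [Submodule.starProjection_apply, ← Submodule.coe_norm,
    ← (stdOrthonormalBasis ℝ Q).sum_sq_norm_inner_right]
  apply Finset.sum_congr rfl
  intro i _
  rw [Submodule.inner_orthogonalProjectionOnto_eq_of_mem_left, Real.norm_eq_abs, sq_abs]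

lemma orthonormal_coe {n : ℕ} (Q : Submodule ℝ (EE n)) :
    Orthonormal ℝ (fun i => ((stdOrthonormalBasis ℝ Q i : Q) : EE n)) :=
  (stdOrthonormalBasis ℝ Q).orthonormal.comp_linearIsometry Q.subtypeₗᵢ

lemma chi_sq_bound {n : ℕ} (Q : Submodule ℝ (EE n)) (t K : ℝ) (ht : t < 1 / 2) :
    ProbabilityTheory.stdGaussian (EE n) {u | K ≤ t * ‖Q.starProjection u‖ ^ 2} ≤
      ENNReal.ofReal (Real.exp (-K) * ((Real.sqrt (1 - 2 * t))⁻¹) ^ (Module.finrank ℝ Q)) := by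
  have := chernoff_sq _ (orthonormal_coe Q) (fun _ => t) (fun _ => ht) K
  simpa [sp_norm_sq, Finset.mul_sum] using this

lemma bad_bound {n : ℕ} (A : Submodule ℝ (EE n)) (μ : EE n) :
    ProbabilityTheory.stdGaussian (EE n)
      {u | ¬ (2 * (inner ℝ (Aᗮ.starProjection μ) u) ^ 2
        ≤ ‖Aᗮ.starProjection μ‖ ^ 2 * ‖Aᗮ.starProjection u‖ ^ 2)} ≤
      ENNReal.ofReal (2 * (Real.sqrt 1.6) ^ (Module.finrank ℝ A) * ((Real.sqrt 1.6)⁻¹) ^ n) := by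
  set v := Aᗮ.starProjection μ with hv
  have hvA : v ∈ Aᗮ := Submodule.starProjection_apply_mem _ _
  by_cases hv0 : v = 0
  · simp [hv0]
  set e := (‖v‖⁻¹ : ℝ) • v with he
  have hnv : 0 < ‖v‖ := norm_pos_iff.mpr hv0
  have heA : e ∈ Aᗮ := Submodule.smul_mem _ _ hvA
  have hen : ‖e‖ = 1 := by
    rw [he, norm_smul, norm_inv, norm_norm, inv_mul_cancel₀ hnv.ne']
  set W := (A ⊔ Submodule.span ℝ {e})ᗮ with hW
  have hWA : W ≤ Aᗮ := Submodule.orthogonal_le le_sup_left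
  have hWe : ∀ w ∈ W, inner ℝ e w = 0 := fun w hw =>
    (Submodule.mem_orthogonal _ _).1 hw e
      (Submodule.mem_sup_right (Submodule.mem_span_singleton_self e))
  let f : Option (Fin (Module.finrank ℝ W)) → EE n := fun o =>
    o.elim e (fun i => ((stdOrthonormalBasis ℝ W i : W) : EE n))
  have hfA : ∀ o, f o ∈ Aᗮ := by
    intro o
    cases o with
    | none => exact heA
    | some i => exact hWA (stdOrthonormalBasis ℝ W i).2
  have hf : Orthonormal ℝ f := by
    have h0 := orthonormal_coe W
    constructor
    · intro o
      cases o with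
      | none => exact hen
      | some i => exact h0.1 i
    · intro o o' hoo
      cases o with
      | none =>
        cases o' with
        | none => exact absurd rfl hoo
        | some i => exact hWe _ (stdOrthonormalBasis ℝ W i).2
      | some i =>
        cases o' with
        | none =>
          change inner ℝ _ e = 0
          rw [real_inner_comm]
          exact hWe _ (stdOrthonormalBasis ℝ W i).2
        | some j => exact h0.2 (fun h => hoo (by rw [h]))
  have hfin : n ≤ Module.finrank ℝ W + (Module.finrank ℝ A + 1) := by
    have h1 := Submodule.finrank_add_finrank_orthogonal (A ⊔ Submodule.span ℝ {e})
    rw [finrank_euclideanSpace_fin] at h1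
    have h2 := Submodule.finrank_add_le_finrank_add_finrank A (Submodule.span ℝ {e})
    have h3 := finrank_span_singleton (K := ℝ) (v := e) (by
      intro h; rw [h] at hen; simp at hen)
    rw [← hW] at h1
    omega
  have hch := chernoff_sq f hf (fun o => o.elim 0.3 (fun _ => -0.3)) (by
    intro o
    cases o <;> norm_num) 0
  refine (measure_mono ?_).trans (hch.trans ?_)
  · intro u hu
    simp only [Set.mem_ofPred_eq, not_le] at hu ⊢
    have hb : ∑ o, (inner ℝ (f o) u) ^ 2 ≤ ‖Aᗮ.starProjection u‖ ^ 2 := by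
      have := hf.sum_inner_products_le (Aᗮ.starProjection u) (s := Finset.univ)
      refine le_trans (le_of_eq ?_) this
      apply Finset.sum_congr rfl
      intro o _
      rw [← Submodule.inner_starProjection_left_eq_right,
        Submodule.starProjection_eq_self_iff.2 (hfA o), Real.norm_eq_abs, sq_abs]
    rw [Fintype.sum_option] at hb ⊢
    have hev : inner ℝ v u = ‖v‖ * inner ℝ e u := by
      rw [he, inner_smul_left]
      simp only [conj_trivial]
      field_simp
    rw [hev] at hu
    have h4 : ‖Aᗮ.starProjection u‖ ^ 2 < 2 * (inner ℝ e u) ^ 2 := by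
      have : ‖v‖ ^ 2 * ‖Aᗮ.starProjection u‖ ^ 2 < ‖v‖ ^ 2 * (2 * (inner ℝ e u) ^ 2) := by
        nlinarith
      exact lt_of_mul_lt_mul_left this (by positivity)
    simp only [f, Option.elim_none, Option.elim_some] at hb ⊢
    rw [← Finset.mul_sum]
    linarith
  · apply ENNReal.ofReal_le_ofReal
    rw [Fintype.prod_option]
    simp only [Option.elim_none, Option.elim_some, Finset.prod_const, Finset.card_univ,
      Fintype.card_fin]
    have h16 : (1 - 2 * (-0.3) : ℝ) = 1.6 := by norm_num
    have h04 : (1 - 2 * 0.3 : ℝ) = 0.4 := by norm_num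
    rw [h16, h04, neg_zero, Real.exp_zero, one_mul]
    set c := Real.sqrt 1.6 with hc
    have hc2 : c ^ 2 = 1.6 := Real.sq_sqrt (by norm_num)
    have hc1 : 1 ≤ c := Real.one_le_sqrt.2 (by norm_num)
    have h4 : Real.sqrt 0.4 = c / 2 := by
      rw [hc, Real.sqrt_eq_iff_mul_self_eq (by norm_num) (by positivity)]
      nlinarith
    rw [h4]
    have hcpos : 0 < c := by linarith
    have h5 : (c⁻¹) ^ (Module.finrank ℝ W) ≤ c ^ (Module.finrank ℝ A + 1) * c⁻¹ ^ n := by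
      rw [inv_pow, inv_pow, ← div_eq_mul_inv, le_div_iff₀ (by positivity), inv_mul_le_iff₀ (by positivity),
        ← pow_add]
      exact pow_le_pow_right₀ hc1 hfin
    calc (c / 2)⁻¹ * c⁻¹ ^ (Module.finrank ℝ W)
        ≤ (c / 2)⁻¹ * (c ^ (Module.finrank ℝ A + 1) * c⁻¹ ^ n) := by gcongr
      _ = _ := by
        rw [pow_succ]
        field_simp

lemma good_lower {n : ℕ} (A : Submodule ℝ (EE n)) (μ u : EE n)
    (h : 2 * (inner ℝ (Aᗮ.starProjection μ) u) ^ 2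
        ≤ ‖Aᗮ.starProjection μ‖ ^ 2 * ‖Aᗮ.starProjection u‖ ^ 2) :
    ‖Aᗮ.starProjection μ‖ ^ 2 ≤ 2 * ‖(A ⊔ Submodule.span ℝ {u})ᗮ.starProjection μ‖ ^ 2 := by
  set B := A ⊔ Submodule.span ℝ {u} with hB
  have h1 : Bᗮ.starProjection μ = μ - B.starProjection μ := by
    rw [Submodule.starProjection_orthogonal_val]
  obtain ⟨a, ha, b, hb, hab⟩ := Submodule.mem_sup.1 (Submodule.starProjection_apply_mem B μ)
  obtain ⟨s, rfl⟩ := Submodule.mem_span_singleton.1 hb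
  set v := Aᗮ.starProjection μ
  set w := Aᗮ.starProjection u
  have h2 : Aᗮ.starProjection (Bᗮ.starProjection μ) = v - s • w := by
    rw [h1, ← hab, map_sub, map_add, map_smul]
    rw [Submodule.starProjection_orthogonal_apply_eq_zero ha, zero_add]
  have h3 : ‖v - s • w‖ ≤ ‖Bᗮ.starProjection μ‖ := by
    rw [← h2]
    exact Submodule.norm_starProjection_apply_le _ _
  have h3' : ‖v - s • w‖ ^ 2 ≤ ‖Bᗮ.starProjection μ‖ ^ 2 := by gcongr
  have hvA : v ∈ Aᗮ := Submodule.starProjection_apply_mem _ _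
  have h4 : inner ℝ v w = inner ℝ v u := by
    rw [← Submodule.inner_starProjection_left_eq_right, Submodule.starProjection_eq_self_iff.2 hvA]
  rw [norm_sub_sq_real, inner_smul_right, h4, norm_smul, mul_pow, Real.norm_eq_abs, sq_abs] at h3'
  set r := inner ℝ v u
  have h5 : 4 * s * r ≤ ‖v‖ ^ 2 + 2 * s ^ 2 * ‖w‖ ^ 2 := by
    by_contra hcon
    push Not at hcon
    have h0 : 0 ≤ ‖v‖ ^ 2 + 2 * s ^ 2 * ‖w‖ ^ 2 := by positivity
    have h6 : (‖v‖ ^ 2 + 2 * s ^ 2 * ‖w‖ ^ 2) ^ 2 < (4 * s * r) ^ 2 := by gcongr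
    nlinarith [sq_nonneg (‖v‖ ^ 2 - 2 * s ^ 2 * ‖w‖ ^ 2), mul_le_mul_of_nonneg_left h (sq_nonneg s)]
  nlinarith

lemma noise_ineq {n : ℕ} (V B B₀ : Submodule ℝ (EE n)) (hVB : V ≤ B) (hVB0 : V ≤ B₀)
    (μ U : EE n) (hμ : μ ∈ B₀) (σ : ℝ)
    (h : ‖Bᗮ.starProjection (μ + σ • U)‖ ^ 2 ≤ ‖B₀ᗮ.starProjection (μ + σ • U)‖ ^ 2) :
    ‖Bᗮ.starProjection μ‖ ^ 2 + 2 * σ * inner ℝ (Bᗮ.starProjection μ) U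
      ≤ σ ^ 2 * ‖(Vᗮ ⊓ B).starProjection U‖ ^ 2 := by
  have h1 : ‖B₀ᗮ.starProjection (μ + σ • U)‖ ^ 2 = σ ^ 2 * ‖B₀ᗮ.starProjection U‖ ^ 2 := by
    rw [map_add, map_smul, Submodule.starProjection_orthogonal_apply_eq_zero hμ, zero_add,
      norm_smul, mul_pow, Real.norm_eq_abs, sq_abs]
  have h2 : ‖B₀ᗮ.starProjection U‖ ^ 2 ≤ ‖Vᗮ.starProjection U‖ ^ 2 := by
    have : B₀ᗮ.starProjection U = B₀ᗮ.starProjection (Vᗮ.starProjection U) := by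
      rw [Submodule.starProjection_orthogonal_val (K := V), map_sub,
        Submodule.starProjection_orthogonal_apply_eq_zero (hVB0 (Submodule.starProjection_apply_mem V U)),
        sub_zero]
    rw [this]
    gcongr
    exact Submodule.norm_starProjection_apply_le _ _
  have h3 : (Vᗮ ⊓ B).starProjection U = B.starProjection (Vᗮ.starProjection U) := by
    have hz : Bᗮ.starProjection (Vᗮ.starProjection U) ∈ Vᗮ :=
      Submodule.orthogonal_le hVB (Submodule.starProjection_apply_mem _ _)
    have hz' : B.starProjection (Vᗮ.starProjection U)
        = Vᗮ.starProjection U - Bᗮ.starProjection (Vᗮ.starProjection U) := by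
      rw [Submodule.starProjection_orthogonal_val (K := B), sub_sub_cancel]
    apply Submodule.eq_starProjection_of_mem_of_inner_eq_zero
    · refine ⟨?_, Submodule.starProjection_apply_mem _ _⟩
      rw [hz']
      exact Submodule.sub_mem _ (Submodule.starProjection_apply_mem _ _) hz
    · intro w hw
      have e1 : U - B.starProjection (Vᗮ.starProjection U)
          = V.starProjection U + Bᗮ.starProjection (Vᗮ.starProjection U) := by
        rw [hz', ← sub_add]
        congr 1
        rw [Submodule.starProjection_orthogonal_val (K := V), sub_sub_cancel]
      rw [e1, inner_add_left,
        Submodule.inner_right_of_mem_orthogonal (Submodule.starProjection_apply_mem V U) hw.1,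
        Submodule.inner_left_of_mem_orthogonal hw.2 (Submodule.starProjection_apply_mem _ _), add_zero]
  have h4 : Bᗮ.starProjection (Vᗮ.starProjection U) = Bᗮ.starProjection U := by
    rw [Submodule.starProjection_orthogonal_val (K := V), map_sub,
        Submodule.starProjection_orthogonal_apply_eq_zero (hVB (Submodule.starProjection_apply_mem V U)),
        sub_zero]
  have h5 := Submodule.norm_sq_eq_add_norm_sq_starProjection (Vᗮ.starProjection U) B
  rw [← h3, h4] at h5
  have h6 : ‖Bᗮ.starProjection (μ + σ • U)‖ ^ 2 = ‖Bᗮ.starProjection μ‖ ^ 2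
      + 2 * σ * inner ℝ (Bᗮ.starProjection μ) U + σ ^ 2 * ‖Bᗮ.starProjection U‖ ^ 2 := by
    rw [map_add, map_smul, norm_add_sq_real, inner_smul_right, norm_smul, mul_pow,
      Real.norm_eq_abs, sq_abs, ← Submodule.inner_starProjection_left_eq_right,
      Submodule.starProjection_eq_self_iff.2 (Submodule.starProjection_apply_mem _ _)]
    ring
  rw [h1, h6] at h
  have := mul_le_mul_of_nonneg_left h2 (sq_nonneg σ)
  rw [h5] at this
  linarith

def colv {n p : ℕ} (X : Matrix (Fin n) (Fin p) ℝ) (j : Fin p) : EE n :=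
  WithLp.toLp 2 (fun i => X i j)

def Asp {n p : ℕ} (X : Matrix (Fin n) (Fin p) ℝ) (τ : Finset (Fin p)) : Submodule ℝ (EE n) :=
  Submodule.span ℝ (colv X '' (τ : Set (Fin p)))

lemma Asp_mono {n p : ℕ} (X : Matrix (Fin n) (Fin p) ℝ) {τ τ' : Finset (Fin p)} (h : τ ⊆ τ') :
    Asp X τ ≤ Asp X τ' :=
  Submodule.span_mono (Set.image_mono (Finset.coe_subset.2 h))

lemma Asp_finrank {n p : ℕ} (X : Matrix (Fin n) (Fin p) ℝ) (τ : Finset (Fin p)) :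
    Module.finrank ℝ (Asp X τ) ≤ τ.card := by
  have h : Asp X τ = Submodule.span ℝ ((τ.image (colv X) : Finset (EE n)) : Set (EE n)) := by
    rw [Asp, Finset.coe_image]
  rw [h]
  exact (finrank_span_finset_le_card _).trans Finset.card_image_le

lemma mulVec_mask {n p : ℕ} (X : Matrix (Fin n) (Fin p) ℝ) (τ : Finset (Fin p)) (β : Fin p → ℝ) :
    WithLp.toLp 2 (X.mulVec (maskOn τ β)) = ∑ j ∈ τ, β j • colv X j := by
  ext i
  simp [Matrix.mulVec, dotProduct, maskOn, colv, Finset.sum_ite_mem, mul_comm]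

lemma mem_Asp {n p : ℕ} (X : Matrix (Fin n) (Fin p) ℝ) (τ : Finset (Fin p)) (z : EE n) :
    z ∈ Asp X τ ↔ ∃ β : Fin p → ℝ, WithLp.toLp 2 (X.mulVec (maskOn τ β)) = z := by
  simp_rw [mulVec_mask]
  exact Submodule.mem_span_image_finset_iff_exists_fun' ℝ

lemma sqnorm_eq {n : ℕ} (v : Fin n → ℝ) : sqnorm v = ‖(WithLp.toLp 2 v : EE n)‖ ^ 2 := by
  rw [EuclideanSpace.real_norm_sq_eq, sqnorm]

lemma objFit_eq {n p : ℕ} (X : Matrix (Fin n) (Fin p) ℝ) (y u : Fin n → ℝ) (τ : Finset (Fin p)) :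
    objFit X y u τ = ‖(Asp X τ ⊔ Submodule.span ℝ {(WithLp.toLp 2 u : EE n)})ᗮ.starProjection
      (WithLp.toLp 2 y)‖ ^ 2 := by
  set B := Asp X τ ⊔ Submodule.span ℝ {(WithLp.toLp 2 u : EE n)} with hB
  have hbdd : BddBelow (Set.range (fun bs : (Fin p → ℝ) × ℝ =>
      sqnorm (y - X.mulVec (maskOn τ bs.1) - bs.2 • u))) :=
    ⟨0, by rintro _ ⟨bs, rfl⟩; simp only [sqnorm]; positivity⟩
  apply le_antisymm
  · obtain ⟨a, ha, b, hb, hab⟩ := Submodule.mem_sup.1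
      (Submodule.starProjection_apply_mem B (WithLp.toLp 2 y))
    obtain ⟨s, rfl⟩ := Submodule.mem_span_singleton.1 hb
    obtain ⟨β, rfl⟩ := (mem_Asp X τ a).1 ha
    refine (ciInf_le hbdd (β, s)).trans (le_of_eq ?_)
    rw [sqnorm_eq, Submodule.starProjection_orthogonal_val (K := B), ← hab, sub_add_eq_sub_sub]
    rfl
  · apply le_ciInf
    rintro ⟨β, s⟩
    rw [sqnorm_eq]
    have hz : (WithLp.toLp 2 (X.mulVec (maskOn τ β)) : EE n) + s • WithLp.toLp 2 u ∈ B :=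
      Submodule.add_mem_sup ((mem_Asp X τ _).2 ⟨β, rfl⟩)
        (Submodule.smul_mem _ _ (Submodule.mem_span_singleton_self _))
    have e1 : Bᗮ.starProjection (WithLp.toLp 2 y) = Bᗮ.starProjection
        (WithLp.toLp 2 (y - X.mulVec (maskOn τ β) - s • u)) := by
      have : (WithLp.toLp 2 (y - X.mulVec (maskOn τ β) - s • u) : EE n)
        = WithLp.toLp 2 y - ((WithLp.toLp 2 (X.mulVec (maskOn τ β)) : EE n) + s • WithLp.toLp 2 u) := by
        rw [sub_add_eq_sub_sub]; rfl
      rw [this, map_sub, Submodule.starProjection_orthogonal_apply_eq_zero hz, sub_zero]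
    rw [e1]
    gcongr
    exact Submodule.norm_starProjection_apply_le _ _

lemma proj_le {n p : ℕ} (X : Matrix (Fin n) (Fin p) ℝ) (τ : Finset (Fin p))
    (hG : IsUnit ((subcols X τ)ᵀ * subcols X τ).det) (μ : Fin n → ℝ) :
    sqnorm ((1 - proj X τ).mulVec μ) ≤ ‖(Asp X τ)ᗮ.starProjection (WithLp.toLp 2 μ)‖ ^ 2 := by
  obtain ⟨β, hβ⟩ := (mem_Asp X τ _).1 (Submodule.starProjection_apply_mem (Asp X τ) (WithLp.toLp 2 μ))
  set M := subcols X τ with hM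
  have hβ' : X.mulVec (maskOn τ β) = M.mulVec (fun j => β j.1) := by
    ext i
    simp only [Matrix.mulVec, dotProduct, maskOn, hM, subcols, Matrix.of_apply, mul_ite, mul_zero,
      Finset.sum_ite_mem, Finset.univ_inter]
    rw [← Finset.sum_coe_sort τ]
  have hPM : proj X τ * M = M := by
    rw [proj, projMat, ← hM, Matrix.mul_assoc, Matrix.mul_assoc, Matrix.nonsing_inv_mul _ hG,
      Matrix.mul_one]
  have hPT : (proj X τ)ᵀ = proj X τ := by
    rw [proj, projMat, ← hM, Matrix.transpose_mul, Matrix.transpose_mul, Matrix.transpose_transpose,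
      Matrix.transpose_nonsing_inv, Matrix.transpose_mul, Matrix.transpose_transpose, Matrix.mul_assoc]
  have hPP : proj X τ * proj X τ = proj X τ := by
    nth_rewrite 2 [proj]
    rw [projMat, ← hM, ← Matrix.mul_assoc, ← Matrix.mul_assoc, hPM, proj, projMat, ← hM]
  set z := μ - X.mulVec (maskOn τ β) with hz
  have e1 : (1 - proj X τ).mulVec μ = (1 - proj X τ).mulVec z := by
    rw [hz, Matrix.mulVec_sub, hβ', Matrix.mulVec_mulVec, Matrix.sub_mul, hPM, Matrix.one_mul, sub_self,
      Matrix.zero_mulVec, sub_zero]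
  have e2 : (Asp X τ)ᗮ.starProjection (WithLp.toLp 2 μ) = WithLp.toLp 2 z := by
    rw [Submodule.starProjection_orthogonal_val (K := Asp X τ), ← hβ]; rfl
  rw [e1, e2, ← sqnorm_eq]
  have hd : ∀ v : Fin n → ℝ, sqnorm v = v ⬝ᵥ v := by
    intro v; simp [sqnorm, dotProduct, sq]
  rw [Matrix.sub_mulVec, Matrix.one_mulVec]
  set w := (proj X τ).mulVec z with hw
  have e3 : w ⬝ᵥ w = z ⬝ᵥ w := by
    rw [hw, Matrix.dotProduct_mulVec, Matrix.vecMul_mulVec, hPT, hPP,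
      ← Matrix.dotProduct_mulVec, dotProduct_comm]
  have hw0 : 0 ≤ w ⬝ᵥ w := by rw [← hd]; simp only [sqnorm]; positivity
  clear_value w
  clear_value z
  rw [hd, hd, sub_dotProduct, dotProduct_sub, dotProduct_sub, dotProduct_comm w z, e3]
  linarith

lemma Cmin_le {n p : ℕ} (X : Matrix (Fin n) (Fin p) ℝ) (τ₀ τ : Finset (Fin p)) (β₀ : Fin p → ℝ)
    (hn : 0 < n)
    (hG : IsUnit ((subcols X τ)ᵀ * subcols X τ).det) (hne : τ ≠ τ₀) (hc : τ.card ≤ τ₀.card) :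
    n * Cmin X τ₀ β₀ * (τ₀ \ τ).card
      ≤ ‖(Asp X τ)ᗮ.starProjection (WithLp.toLp 2 (X.mulVec β₀))‖ ^ 2 := by
  refine le_trans ?_ (proj_le X τ hG _)
  have hk : 1 ≤ (τ₀ \ τ).card := by
    rw [Nat.one_le_iff_ne_zero, Finset.card_ne_zero, Finset.sdiff_nonempty]
    intro h
    exact hne (Finset.eq_of_subset_of_card_le h hc).symm
  have h1 : Cmin X τ₀ β₀ ≤ sqnorm ((1 - proj X τ).mulVec (X.mulVec β₀)) /
        ((n * max (τ₀ \ τ).card 1 : ℕ) : ℝ) := by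
    apply csInf_le
    · refine ⟨0, ?_⟩
      rintro _ ⟨t, _, rfl⟩
      simp only [sqnorm]
      positivity
    · exact ⟨τ, ⟨hne, hc⟩, rfl⟩
  rw [max_eq_left hk, le_div_iff₀ (by positivity)] at h1
  push_cast at h1
  linarith

lemma rank_diff {n p : ℕ} (X : Matrix (Fin n) (Fin p) ℝ) (τ τ₀ : Finset (Fin p)) (u : EE n) :
    Module.finrank ℝ ((Asp X (τ ∩ τ₀) ⊔ Submodule.span ℝ {u})ᗮ ⊓ (Asp X τ ⊔ Submodule.span ℝ {u})
      : Submodule ℝ (EE n)) ≤ (τ \ τ₀).card := by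
  set V := Asp X (τ ∩ τ₀) ⊔ Submodule.span ℝ {u} with hV
  set B := Asp X τ ⊔ Submodule.span ℝ {u} with hB
  have hVB : V ≤ B := sup_le_sup_right (Asp_mono X Finset.inter_subset_left) _
  have h1 := Submodule.finrank_add_inf_finrank_orthogonal hVB
  have h2 : B ≤ V ⊔ Asp X (τ \ τ₀) := by
    have : Asp X τ ≤ Asp X (τ ∩ τ₀) ⊔ Asp X (τ \ τ₀) := by
      rw [Asp, Asp, Asp, ← Submodule.span_union, ← Set.image_union]
      apply Submodule.span_mono
      apply Set.image_mono
      intro j hj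
      by_cases h : j ∈ τ₀ <;> simp_all
    refine sup_le (this.trans ?_) (le_sup_right.trans le_sup_left)
    exact sup_le (le_sup_left.trans le_sup_left) le_sup_right
  have h3 := Submodule.finrank_mono h2
  have h4 := Submodule.finrank_add_le_finrank_add_finrank V (Asp X (τ \ τ₀))
  have h5 := Asp_finrank X (τ \ τ₀)
  omega

lemma std_transfer {n : ℕ} (T : Set (EE n)) :
    stdGaussian n {u | (WithLp.toLp 2 u : EE n) ∈ T} = ProbabilityTheory.stdGaussian (EE n) T := by
  rw [← map_pi_eq_stdGaussian]
  exact ((MeasurableEquiv.toLp 2 (Fin n → ℝ)).map_apply T).symm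

lemma count_small {p s : ℕ} (hp : 1 ≤ p) (c : ℝ) (hc : 0 ≤ c) :
    ∑ τ ∈ (Finset.univ : Finset (Finset (Fin p))).filter (fun τ => τ.card ≤ s), c ^ τ.card
      ≤ (p : ℝ) ^ s * Real.exp c := by
  rw [← Finset.sum_fiberwise_of_maps_to (g := Finset.card) (t := Finset.range (s + 1))
    (by intro τ h; simp at h ⊢; omega)]
  calc _ ≤ ∑ j ∈ Finset.range (s + 1), (p : ℝ) ^ s * (c ^ j / j.factorial) := by
        apply Finset.sum_le_sum
        intro j hj
        have hj' : j ≤ s := by simp at hj; omega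
        have hp' : (1 : ℝ) ≤ p := by exact_mod_cast hp
        rw [Finset.sum_congr rfl (g := fun _ => c ^ j) (by intro τ h; simp at h; rw [h.2])]
        rw [Finset.sum_const, nsmul_eq_mul]
        have h1 : (Finset.filter (fun τ => τ.card = j) (Finset.filter (fun τ => τ.card ≤ s)
            (Finset.univ : Finset (Finset (Fin p))))).card ≤ p.choose j := by
          have : (Finset.powersetCard j (Finset.univ : Finset (Fin p))).card = p.choose j := by simp
          rw [← this]
          apply Finset.card_le_card
          intro τ h
          simp at h ⊢
          exact h.2
        have h2 : (p.choose j : ℝ) ≤ p ^ j / j.factorial := Nat.choose_le_pow_div j p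
        have h3 : (p : ℝ) ^ j ≤ p ^ s := pow_le_pow_right₀ hp' hj'
        calc _ ≤ (p.choose j : ℝ) * c ^ j := by
              gcongr
          _ ≤ (p ^ j / j.factorial) * c ^ j := by gcongr
          _ ≤ (p ^ s / j.factorial) * c ^ j := by gcongr
          _ = _ := by ring
    _ ≤ _ := by
        rw [← Finset.mul_sum]
        gcongr
        exact Real.sum_le_exp_of_nonneg hc _

def Good {n p : ℕ} (X : Matrix (Fin n) (Fin p) ℝ) (τ₀ : Finset (Fin p)) (β₀ : Fin p → ℝ)
    (u : Fin n → ℝ) : Prop :=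
  ∀ τ : Finset (Fin p), τ.card ≤ τ₀.card →
    2 * (inner ℝ ((Asp X τ)ᗮ.starProjection (WithLp.toLp 2 (X.mulVec β₀))) (WithLp.toLp 2 u : EE n)) ^ 2
        ≤ ‖(Asp X τ)ᗮ.starProjection (WithLp.toLp 2 (X.mulVec β₀))‖ ^ 2 *
          ‖(Asp X τ)ᗮ.starProjection (WithLp.toLp 2 u)‖ ^ 2

lemma bad_prob {n p : ℕ} (X : Matrix (Fin n) (Fin p) ℝ) (τ₀ : Finset (Fin p)) (β₀ : Fin p → ℝ)
    (hp : 1 ≤ p) :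
    stdGaussian n {u | ¬ Good X τ₀ β₀ u} ≤
      ENNReal.ofReal (Real.exp (-(0.23 * n) + τ₀.card * Real.log p + 2)) := by
  set μ : EE n := WithLp.toLp 2 (X.mulVec β₀) with hμ
  set F := (Finset.univ : Finset (Finset (Fin p))).filter (fun τ => τ.card ≤ τ₀.card) with hF
  set c := Real.sqrt 1.6 with hc
  have hc2 : c ^ 2 = 1.6 := Real.sq_sqrt (by norm_num)
  have hc1 : 1 ≤ c := Real.one_le_sqrt.2 (by norm_num)
  have hsub : {u | ¬ Good X τ₀ β₀ u} ⊆ ⋃ τ ∈ F, {u | (WithLp.toLp 2 u : EE n) ∈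
      {u : EE n | ¬ (2 * (inner ℝ ((Asp X τ)ᗮ.starProjection μ) u) ^ 2
        ≤ ‖(Asp X τ)ᗮ.starProjection μ‖ ^ 2 * ‖(Asp X τ)ᗮ.starProjection u‖ ^ 2)}} := by
    intro u hu
    simp only [Good, Set.mem_ofPred_eq, not_forall] at hu
    obtain ⟨τ, h1, h2⟩ := hu
    simp only [Set.mem_iUnion]
    exact ⟨τ, by simp [hF, h1], h2⟩
  refine (measure_mono hsub).trans ((measure_biUnion_finset_le _ _).trans ?_)
  have h1 : ∀ τ ∈ F, stdGaussian n {u | (WithLp.toLp 2 u : EE n) ∈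
      {u : EE n | ¬ (2 * (inner ℝ ((Asp X τ)ᗮ.starProjection μ) u) ^ 2
        ≤ ‖(Asp X τ)ᗮ.starProjection μ‖ ^ 2 * ‖(Asp X τ)ᗮ.starProjection u‖ ^ 2)}}
      ≤ ENNReal.ofReal (2 * c ^ τ.card * c⁻¹ ^ n) := by
    intro τ _
    rw [std_transfer]
    refine (bad_bound (Asp X τ) μ).trans (ENNReal.ofReal_le_ofReal ?_)
    have := Asp_finrank X τ
    gcongr
  refine (Finset.sum_le_sum h1).trans ?_
  rw [← ENNReal.ofReal_sum_of_nonneg (by intros; positivity)]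
  apply ENNReal.ofReal_le_ofReal
  rw [← Finset.sum_mul, ← Finset.mul_sum]
  have h2 := count_small (s := τ₀.card) hp c (by linarith)
  rw [← hF] at h2
  have hp' : (0 : ℝ) < p := by exact_mod_cast hp
  have h3 : (p : ℝ) ^ τ₀.card = Real.exp (τ₀.card * Real.log p) := by
    rw [mul_comm, Real.exp_mul, Real.exp_log hp', Real.rpow_natCast]
  have h4 : 2 * Real.exp c ≤ Real.exp 2 := by
    have h5 : c ≤ 1.265 := by nlinarith
    have h6 := Real.log_two_lt_d9
    calc 2 * Real.exp c = Real.exp (Real.log 2 + c) := by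
          rw [Real.exp_add, Real.exp_log (by norm_num)]
      _ ≤ _ := Real.exp_le_exp.2 (by linarith)
  have h7 : c⁻¹ ^ n ≤ Real.exp (-(0.23 * n)) := by
    have h8 : Real.exp 0.23 ≤ c := by
      have := Real.exp_bound' (x := 0.23) (by norm_num) (by norm_num) (n := 4) (by norm_num)
      norm_num [Finset.sum_range_succ, Nat.factorial] at this
      norm_num at this ⊢
      have h9 : (1.2648 : ℝ) ≤ c := by
        rw [hc]; apply Real.le_sqrt_of_sq_le; norm_num
      norm_num at h9
      linarith
    have h10 : Real.exp (-(0.23 * n)) = ((Real.exp 0.23)⁻¹) ^ n := by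
      rw [← Real.exp_neg, ← Real.exp_nat_mul]
      congr 1; ring
    rw [h10]
    gcongr
  calc 2 * (∑ τ ∈ F, c ^ τ.card) * c⁻¹ ^ n
      ≤ 2 * ((p : ℝ) ^ τ₀.card * Real.exp c) * Real.exp (-(0.23 * n)) := by gcongr
    _ = (2 * Real.exp c) * (p : ℝ) ^ τ₀.card * Real.exp (-(0.23 * n)) := by ring
    _ ≤ Real.exp 2 * (p : ℝ) ^ τ₀.card * Real.exp (-(0.23 * n)) := by gcongr
    _ = _ := by
      rw [h3, ← Real.exp_add, ← Real.exp_add]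
      congr 1; ring

lemma noise_one {n p : ℕ} (X : Matrix (Fin n) (Fin p) ℝ) (τ₀ τ : Finset (Fin p)) (β₀ : Fin p → ℝ)
    (hβsupp : ∀ j ∉ τ₀, β₀ j = 0) (σ₀ : ℝ) (hσ₀ : 0 < σ₀) (hn : 0 < n)
    (hG : IsUnit ((subcols X τ)ᵀ * subcols X τ).det) (hne : τ ≠ τ₀) (hc : τ.card ≤ τ₀.card)
    (hC : 0 ≤ Cmin X τ₀ β₀)
    (u : Fin n → ℝ) (hu : Good X τ₀ β₀ u) :
    stdGaussian n {U | objFit X (X.mulVec β₀ + σ₀ • U) u τ ≤ objFit X (X.mulVec β₀ + σ₀ • U) u τ₀}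
      ≤ ENNReal.ofReal (2 * (5 / 4 * Real.exp (-(n * Cmin X τ₀ β₀ / σ₀ ^ 2) / 60)) ^
        (symmDiff τ τ₀).card) := by
  set C := Cmin X τ₀ β₀ with hCdef
  set μ : EE n := WithLp.toLp 2 (X.mulVec β₀) with hμ
  set u' : EE n := WithLp.toLp 2 u with hu'
  set V := Asp X (τ ∩ τ₀) ⊔ Submodule.span ℝ {u'} with hV
  set B := Asp X τ ⊔ Submodule.span ℝ {u'} with hB
  set B₀ := Asp X τ₀ ⊔ Submodule.span ℝ {u'} with hB₀
  have hVB : V ≤ B := sup_le_sup_right (Asp_mono X Finset.inter_subset_left) _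
  have hVB0 : V ≤ B₀ := sup_le_sup_right (Asp_mono X Finset.inter_subset_right) _
  have hμB : μ ∈ B₀ := by
    apply Submodule.mem_sup_left
    rw [mem_Asp]
    refine ⟨β₀, ?_⟩
    have : maskOn τ₀ β₀ = β₀ := by
      ext j
      by_cases h : j ∈ τ₀ <;> simp [maskOn, h, hβsupp]
    rw [this]
  set k := (τ₀ \ τ).card with hk
  set j := (τ \ τ₀).card with hj
  have hjk : j ≤ k := by
    have h1 := Finset.card_sdiff_add_card_inter τ τ₀
    have h2 := Finset.card_sdiff_add_card_inter τ₀ τ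
    rw [Finset.inter_comm] at h2
    omega
  have hsd : (symmDiff τ τ₀).card = j + k := by
    rw [symmDiff, Finset.sup_eq_union, Finset.card_union_of_disjoint]
    exact disjoint_sdiff_sdiff
  set D := ‖Bᗮ.starProjection μ‖ ^ 2 with hD
  have hDk : n * C * k ≤ 2 * D :=
    (Cmin_le X τ₀ τ β₀ hn hG hne hc).trans (good_lower (Asp X τ) μ u' (hu τ hc))
  set Q := Vᗮ ⊓ B with hQ
  have hQr : Module.finrank ℝ Q ≤ j := rank_diff X τ τ₀ u'
  have hsub : {U | objFit X (X.mulVec β₀ + σ₀ • U) u τ ≤ objFit X (X.mulVec β₀ + σ₀ • U) u τ₀}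
      ⊆ {U | (WithLp.toLp 2 U : EE n) ∈
        ({U : EE n | 9 / 64 * D / σ₀ ^ 2 ≤ inner ℝ (-(3 / 8 / σ₀) • Bᗮ.starProjection μ) U} ∪
         {U : EE n | D / σ₀ ^ 2 / 15 ≤ (4 / 15) * ‖Q.starProjection U‖ ^ 2})} := by
    intro U hU
    simp only [Set.mem_ofPred_eq, objFit_eq] at hU
    have h1 := noise_ineq V B B₀ hVB hVB0 μ (WithLp.toLp 2 U) hμB σ₀ hU
    simp only [Set.mem_ofPred_eq, Set.mem_union]
    rw [← hD] at h1
    rw [inner_smul_left]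
    simp only [conj_trivial]
    set r := inner ℝ (Bᗮ.starProjection μ) (WithLp.toLp 2 U : EE n)
    set q := ‖Q.starProjection (WithLp.toLp 2 U : EE n)‖ ^ 2
    by_contra hcon
    rw [not_or, not_le, not_le] at hcon
    obtain ⟨h2, h3⟩ := hcon
    have hs2 : 0 < σ₀ ^ 2 := by positivity
    have h2' : -(3 / 8 * D) < σ₀ * r := by
      have : -(3 / 8 / σ₀) * r * σ₀ ^ 2 < 9 / 64 * D / σ₀ ^ 2 * σ₀ ^ 2 := by gcongr
      rw [div_mul_cancel₀ _ hs2.ne'] at this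
      have e : -(3 / 8 / σ₀) * r * σ₀ ^ 2 = -(3 / 8) * (σ₀ * r) := by field_simp
      rw [e] at this
      linarith
    have h3' : 4 * (σ₀ ^ 2 * q) < D := by
      have : 4 / 15 * q * σ₀ ^ 2 < D / σ₀ ^ 2 / 15 * σ₀ ^ 2 := by gcongr
      have e : D / σ₀ ^ 2 / 15 * σ₀ ^ 2 = D / 15 := by field_simp
      rw [e] at this
      linarith
    linarith
  refine (measure_mono hsub).trans ?_
  rw [std_transfer]
  refine (measure_union_le _ _).trans ?_
  have b1 := chernoff_lin (-(3 / 8 / σ₀) • Bᗮ.starProjection μ) (9 / 64 * D / σ₀ ^ 2)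
  have b2 := chi_sq_bound Q (4 / 15) (D / σ₀ ^ 2 / 15) (by norm_num)
  refine (add_le_add b1 b2).trans ?_
  rw [← ENNReal.ofReal_add (by positivity) (by positivity)]
  apply ENNReal.ofReal_le_ofReal
  rw [norm_smul, mul_pow, ← hD, Real.norm_eq_abs, sq_abs]
  set x := n * C / σ₀ ^ 2 with hx
  have hx0 : 0 ≤ x := by positivity
  have hs2 : 0 < σ₀ ^ 2 := by positivity
  have hD0 : 0 ≤ D := by positivity
  have hxD : x * k / 2 ≤ D / σ₀ ^ 2 := by
    rw [le_div_iff₀ hs2, hx]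
    have : n * C / σ₀ ^ 2 * k / 2 * σ₀ ^ 2 = n * C * k / 2 := by field_simp
    rw [this]; linarith
  have hjk' : (j : ℝ) ≤ k := by exact_mod_cast hjk
  have hexp : x * (j + k) / 60 ≤ x * k / 30 := by
    have := mul_le_mul_of_nonneg_left hjk' hx0
    linarith
  have e1 : Real.exp (-(9 / 64 * D / σ₀ ^ 2) + (-(3 / 8 / σ₀)) ^ 2 * D / 2)
      ≤ Real.exp (-x / 60) ^ (j + k) := by
    rw [← Real.exp_nat_mul]
    apply Real.exp_le_exp.2
    have : -(9 / 64 * D / σ₀ ^ 2) + (-(3 / 8 / σ₀)) ^ 2 * D / 2 = - (9 / 128) * (D / σ₀ ^ 2) := by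
      field_simp
      ring
    rw [this]
    push_cast
    have : 0 ≤ x * k := by positivity
    linarith
  have e2 : Real.exp (-(D / σ₀ ^ 2 / 15)) ≤ Real.exp (-x / 60) ^ (j + k) := by
    rw [← Real.exp_nat_mul]
    apply Real.exp_le_exp.2
    push_cast
    linarith
  have e3 : ((Real.sqrt (1 - 2 * (4 / 15)))⁻¹) ^ (Module.finrank ℝ Q) ≤ (5 / 4 : ℝ) ^ (j + k) := by
    have h1 : (Real.sqrt (1 - 2 * (4 / 15)))⁻¹ ≤ (5 / 4 : ℝ) ^ 2 := by
      rw [inv_le_comm₀ (by apply Real.sqrt_pos.2; norm_num) (by norm_num)]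
      apply Real.le_sqrt_of_sq_le
      norm_num
    calc _ ≤ ((5 / 4 : ℝ) ^ 2) ^ (Module.finrank ℝ Q) := by gcongr
      _ = (5 / 4 : ℝ) ^ (2 * Module.finrank ℝ Q) := by rw [pow_mul]
      _ ≤ _ := pow_le_pow_right₀ (by norm_num) (by omega)
  have e4 : (1 : ℝ) ≤ (5 / 4 : ℝ) ^ (j + k) := one_le_pow₀ (by norm_num)
  rw [hsd, mul_pow]
  set E := Real.exp (-x / 60) ^ (j + k)
  have hE : 0 ≤ E := by positivity
  have e5 : Real.exp (-(D / σ₀ ^ 2 / 15)) * ((Real.sqrt (1 - 2 * (4 / 15)))⁻¹) ^ (Module.finrank ℝ Q)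
      ≤ E * (5 / 4 : ℝ) ^ (j + k) := by gcongr
  nlinarith

lemma sum_symm {p : ℕ} (τ₀ : Finset (Fin p)) (z : ℝ) :
    ∑ τ : Finset (Fin p), z ^ (symmDiff τ τ₀).card = (z + 1) ^ p := by
  have h := Fintype.sum_pow_mul_eq_add_pow (Fin p) z 1
  simp only [one_pow, mul_one, Fintype.card_fin] at h
  rw [← h]
  exact Fintype.sum_equiv (Function.Involutive.toPerm _ (symmDiff_left_involutive τ₀)) _ _ (fun _ => rfl)

lemma noise_all {n p : ℕ} (X : Matrix (Fin n) (Fin p) ℝ) (τ₀ : Finset (Fin p)) (β₀ : Fin p → ℝ)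
    (hβsupp : ∀ j ∉ τ₀, β₀ j = 0) (σ₀ : ℝ) (hσ₀ : 0 < σ₀) (hn : 0 < n) (hp : 1 ≤ p)
    (hG : ∀ τ : Finset (Fin p), τ.card ≤ τ₀.card → IsUnit ((subcols X τ)ᵀ * subcols X τ).det)
    (hC : 0 ≤ Cmin X τ₀ β₀)
    (hsmall : 6 * (p : ℝ) ^ 2 * Real.exp (-(n * Cmin X τ₀ β₀ / σ₀ ^ 2) / 60) ≤ 1)
    (u : Fin n → ℝ) (hu : Good X τ₀ β₀ u) :
    stdGaussian n {U | ∃ τ, τ ≠ τ₀ ∧ τ.card ≤ τ₀.card ∧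
        objFit X (X.mulVec β₀ + σ₀ • U) u τ ≤ objFit X (X.mulVec β₀ + σ₀ • U) u τ₀}
      ≤ ENNReal.ofReal (6 * (p : ℝ) ^ 2 * Real.exp (-(n * Cmin X τ₀ β₀ / σ₀ ^ 2) / 60)) := by
  set E := Real.exp (-(n * Cmin X τ₀ β₀ / σ₀ ^ 2) / 60) with hE
  have hE0 : 0 < E := Real.exp_pos _
  set z := 5 / 4 * E with hz
  set F := (Finset.univ : Finset (Finset (Fin p))).filter
    (fun τ => τ ≠ τ₀ ∧ τ.card ≤ τ₀.card) with hF
  have hsub : {U | ∃ τ, τ ≠ τ₀ ∧ τ.card ≤ τ₀.card ∧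
        objFit X (X.mulVec β₀ + σ₀ • U) u τ ≤ objFit X (X.mulVec β₀ + σ₀ • U) u τ₀} ⊆
      ⋃ τ ∈ F, {U | objFit X (X.mulVec β₀ + σ₀ • U) u τ ≤ objFit X (X.mulVec β₀ + σ₀ • U) u τ₀} := by
    rintro U ⟨τ, h1, h2, h3⟩
    simp only [Set.mem_iUnion]
    exact ⟨τ, by simp [hF, h1, h2], h3⟩
  refine (measure_mono hsub).trans ((measure_biUnion_finset_le _ _).trans ?_)
  have h1 : ∀ τ ∈ F, stdGaussian n
      {U | objFit X (X.mulVec β₀ + σ₀ • U) u τ ≤ objFit X (X.mulVec β₀ + σ₀ • U) u τ₀}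
      ≤ ENNReal.ofReal (2 * z ^ (symmDiff τ τ₀).card) := by
    intro τ hτ
    simp only [hF, Finset.mem_filter, Finset.mem_univ, true_and] at hτ
    exact noise_one X τ₀ τ β₀ hβsupp σ₀ hσ₀ hn (hG τ hτ.2) hτ.1 hτ.2 hC u hu
  refine (Finset.sum_le_sum h1).trans ?_
  rw [← ENNReal.ofReal_sum_of_nonneg (by intros; positivity)]
  apply ENNReal.ofReal_le_ofReal
  rw [← Finset.mul_sum]
  have hp' : (1 : ℝ) ≤ p := by exact_mod_cast hp
  have h2 : ∑ τ ∈ F, z ^ (symmDiff τ τ₀).card ≤ (z + 1) ^ p - 1 := by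
    rw [← sum_symm τ₀ z, le_sub_iff_add_le]
    have h3 : τ₀ ∉ F := by simp [hF]
    have h4 : ∑ τ ∈ insert τ₀ F, z ^ (symmDiff τ τ₀).card
        = 1 + ∑ τ ∈ F, z ^ (symmDiff τ τ₀).card := by
      rw [Finset.sum_insert h3]; simp
    rw [add_comm, ← h4]
    exact Finset.sum_le_sum_of_subset_of_nonneg (Finset.subset_univ _) (by intros; positivity)
  have h5 : (z + 1) ^ p ≤ Real.exp (p * z) := by
    rw [Real.exp_nat_mul]
    have := Real.add_one_le_exp z
    gcongr
  have hpp : (p : ℝ) ≤ (p : ℝ) ^ 2 := by nlinarith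
  have h6 : (p : ℝ) * E ≤ (p : ℝ) ^ 2 * E := mul_le_mul_of_nonneg_right hpp hE0.le
  have h7 : p * z ≤ 1 := by rw [hz]; linarith
  have h0 : 0 ≤ p * z := by positivity
  have h8 := Real.abs_exp_sub_one_le (x := p * z) (by rw [abs_of_nonneg h0]; exact h7)
  rw [abs_of_nonneg h0] at h8
  have h9 := le_of_abs_le h8
  have h10 : p * z = 5 / 4 * (p * E) := by rw [hz]; ring
  have h11 : 0 ≤ (p : ℝ) ^ 2 * E := by positivity
  nlinarith

instance isProb_std (n : ℕ) : IsProbabilityMeasure (stdGaussian n) := by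
  unfold stdGaussian; infer_instance

instance isProb_joint (n d : ℕ) : IsProbabilityMeasure (jointMeasure n d) := by
  unfold jointMeasure; infer_instance

lemma Cmin_nonneg {n p : ℕ} (X : Matrix (Fin n) (Fin p) ℝ) (τ₀ : Finset (Fin p))
    (β₀ : Fin p → ℝ) : 0 ≤ Cmin X τ₀ β₀ := by
  apply Real.sInf_nonneg
  rintro _ ⟨τ, _, rfl⟩
  exact div_nonneg (Finset.sum_nonneg fun i _ => sq_nonneg _) (Nat.cast_nonneg _)

lemma measurable_Good {n p : ℕ} (X : Matrix (Fin n) (Fin p) ℝ) (τ₀ : Finset (Fin p))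
    (β₀ : Fin p → ℝ) : MeasurableSet {u | Good X τ₀ β₀ u} := by
  apply IsClosed.measurableSet
  simp only [Good, Set.ofPred_forall]
  refine isClosed_iInter fun τ => isClosed_iInter fun _ => ?_
  apply isClosed_le
  · fun_prop
  · fun_prop

lemma measurable_objFit {n p : ℕ} (X : Matrix (Fin n) (Fin p) ℝ) (τ : Finset (Fin p)) :
    Measurable (fun q : (Fin n → ℝ) × (Fin n → ℝ) => objFit X q.1 q.2 τ) := by
  apply UpperSemicontinuous.measurable
  unfold objFit
  apply upperSemicontinuous_ciInf
  · intro q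
    refine ⟨0, ?_⟩
    rintro _ ⟨bs, rfl⟩
    exact Finset.sum_nonneg fun i _ => sq_nonneg _
  · intro bs
    apply Continuous.upperSemicontinuous
    unfold sqnorm
    fun_prop

/-- Main probability estimate. -/
lemma joint_bound {n d : ℕ} (G : Set (Fin n → ℝ)) (hG : MeasurableSet G)
    (N : Set ((Fin n → ℝ) × (Fin n → ℝ))) (hN : MeasurableSet N) (K L : ℝ≥0∞)
    (hK : ∀ u ∈ G, stdGaussian n {U | (U, u) ∈ N} ≤ K)
    (hL : stdGaussian n Gᶜ ≤ L)
    (S : Set ((Fin n → ℝ) × (Fin d → Fin n → ℝ)))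
    (hS : ∀ ω ∈ S, ∀ b, ω.2 b ∈ G → (ω.1, ω.2 b) ∈ N) :
    jointMeasure n d S ≤ K + L ^ d := by
  set E1 : Set ((Fin n → ℝ) × (Fin d → Fin n → ℝ)) :=
    Set.univ ×ˢ (Set.univ.pi fun _ => Gᶜ) with hE1
  set E2 : Set ((Fin n → ℝ) × (Fin d → Fin n → ℝ)) :=
    ⋃ b : Fin d, ({ω | ω.2 b ∈ G} ∩ (⋂ b' : Fin d, ⋂ _ : b' < b, {ω | ω.2 b' ∈ Gᶜ}) ∩
      {ω | (ω.1, ω.2 b) ∈ N}) with hE2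
  have hmeas : MeasurableSet E2 := by
    refine MeasurableSet.iUnion fun b => ((?_ : MeasurableSet _).inter ?_).inter ?_
    · exact (by fun_prop : Measurable
        fun ω : (Fin n → ℝ) × (Fin d → Fin n → ℝ) => ω.2 b) hG
    · refine MeasurableSet.iInter fun b' => MeasurableSet.iInter fun _ => ?_
      exact (by fun_prop : Measurable
        fun ω : (Fin n → ℝ) × (Fin d → Fin n → ℝ) => ω.2 b') hG.compl
    · exact (by fun_prop : Measurable
        fun ω : (Fin n → ℝ) × (Fin d → Fin n → ℝ) => (ω.1, ω.2 b)) hN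
  have hsub : S ⊆ E2 ∪ E1 := by
    intro ω hω
    by_cases h : ∃ b, ω.2 b ∈ G
    · left
      have hwf := wellFounded_lt (α := Fin d)
      refine Set.mem_iUnion.2 ⟨hwf.min {b | ω.2 b ∈ G} h, ?_⟩
      have h1 : ω.2 (hwf.min {b | ω.2 b ∈ G} h) ∈ G := hwf.min_mem {b | ω.2 b ∈ G} h
      refine ⟨⟨h1, ?_⟩, hS ω hω _ h1⟩
      simp only [Set.mem_iInter]
      intro b' hb' hg
      exact hwf.not_lt_min {b | ω.2 b ∈ G} hg hb'
    · right
      push Not at h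
      simp only [hE1, Set.mem_prod, Set.mem_univ, true_and, Set.mem_pi]
      exact fun b _ => h b
  have b1 : jointMeasure n d E1 ≤ L ^ d := by
    rw [hE1, jointMeasure, Measure.prod_prod, Measure.pi_pi, measure_univ, one_mul,
      Finset.prod_const, Finset.card_univ, Fintype.card_fin]
    gcongr
  have b2 : jointMeasure n d E2 ≤ K := by
    rw [jointMeasure, Measure.prod_apply_symm hmeas]
    calc _ ≤ ∫⁻ _, K ∂(Measure.pi fun _ : Fin d => stdGaussian n) := by
          apply lintegral_mono
          intro v
          by_cases h : ∃ b, v b ∈ G ∧ ∀ b' < b, v b' ∉ G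
          · obtain ⟨b, hb, hb2⟩ := h
            refine (measure_mono ?_).trans (hK _ hb)
            intro U hU
            obtain ⟨c, ⟨hc1, hc2⟩, hc3⟩ := Set.mem_iUnion.1 hU
            simp only [Set.mem_iInter] at hc2
            have : c = b := by
              rcases lt_trichotomy c b with h | h | h
              · exact absurd hc1 (hb2 c h)
              · exact h
              · exact absurd hb (hc2 b h)
            subst this
            exact hc3
          · have : (fun x => (x, v)) ⁻¹' E2 = ∅ := by
              rw [Set.eq_empty_iff_forall_notMem]
              intro U hU
              obtain ⟨c, ⟨hc1, hc2⟩, hc3⟩ := Set.mem_iUnion.1 hU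
              simp only [Set.mem_iInter] at hc2
              exact h ⟨c, hc1, hc2⟩
            simp [this]
      _ = K := by simp
  exact (measure_mono hsub).trans ((measure_union_le _ _).trans (add_le_add b2 b1))

lemma measurable_shift {n p : ℕ} (X : Matrix (Fin n) (Fin p) ℝ) (m : Fin n → ℝ) (σ₀ : ℝ)
    (τ : Finset (Fin p)) :
    Measurable (fun q : (Fin n → ℝ) × (Fin n → ℝ) => objFit X (m + σ₀ • q.1) q.2 τ) := by
  have h : Measurable fun q : (Fin n → ℝ) × (Fin n → ℝ) => (m + σ₀ • q.1, q.2) :=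
    ((measurable_fst.const_smul σ₀).const_add m).prodMk measurable_snd
  have h2 := (measurable_objFit X τ).comp h
  simp only [Function.comp_def] at h2
  exact h2

lemma measurable_N {n p : ℕ} (X : Matrix (Fin n) (Fin p) ℝ) (m : Fin n → ℝ) (σ₀ : ℝ)
    (τ₀ : Finset (Fin p)) :
    MeasurableSet {q : (Fin n → ℝ) × (Fin n → ℝ) | ∃ τ, τ ≠ τ₀ ∧ τ.card ≤ τ₀.card ∧
        objFit X (m + σ₀ • q.1) q.2 τ ≤ objFit X (m + σ₀ • q.1) q.2 τ₀} := by
  have : {q : (Fin n → ℝ) × (Fin n → ℝ) | ∃ τ, τ ≠ τ₀ ∧ τ.card ≤ τ₀.card ∧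
        objFit X (m + σ₀ • q.1) q.2 τ ≤ objFit X (m + σ₀ • q.1) q.2 τ₀}
      = ⋃ τ : Finset (Fin p), ⋃ _ : τ ≠ τ₀ ∧ τ.card ≤ τ₀.card,
      {q | objFit X (m + σ₀ • q.1) q.2 τ ≤ objFit X (m + σ₀ • q.1) q.2 τ₀} := by
    ext q
    simp only [Set.mem_iUnion, Set.mem_ofPred_eq, exists_prop, and_assoc]
  rw [this]
  exact MeasurableSet.iUnion fun τ => MeasurableSet.iUnion fun _ =>
    measurableSet_le (measurable_shift X m σ₀ τ) (measurable_shift X m σ₀ τ₀)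

/-- **Theorem A.2.** Large-sample (finite-`d`) bound for the constrained
(size `≤ |τ₀|`) repro-samples candidate set. -/
theorem constrained_candidate_set_large_sample {n p : ℕ}
    (X : Matrix (Fin n) (Fin p) ℝ) (τ₀ : Finset (Fin p)) (β₀ : Fin p → ℝ)
    (hβsupp : ∀ j ∉ τ₀, β₀ j = 0) (hβne : ∀ j ∈ τ₀, β₀ j ≠ 0)
    (σ₀ : ℝ) (hσ₀ : 0 < σ₀)
    (hGram : ∀ τ : Finset (Fin p), τ.card ≤ τ₀.card →
      IsUnit ((subcols X τ)ᵀ * subcols X τ).det)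
    (hid : Identifiable X τ₀ β₀)
    (tauHat : (Fin n → ℝ) → (Fin n → ℝ) → Finset (Fin p))
    (hcard : ∀ y ustar : Fin n → ℝ, (tauHat y ustar).card ≤ τ₀.card)
    (hmin : ∀ (y ustar : Fin n → ℝ) (τ : Finset (Fin p)), τ.card ≤ τ₀.card →
      objFit X y ustar (tauHat y ustar) ≤ objFit X y ustar τ)
    (d : ℕ) :
    jointMeasure n d
        {ω | ∀ b : Fin d, tauHat (X.mulVec β₀ + σ₀ • ω.1) (ω.2 b) ≠ τ₀} ≤
      ENNReal.ofReal
        (6 * Real.exp (-((n : ℝ) / (18 * σ₀ ^ 2)) *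
            (0.3 * Cmin X τ₀ β₀ - 36 * (Real.log (p : ℝ) / (n : ℝ)) * σ₀ ^ 2)) +
          Real.exp (-((n : ℝ) * (d : ℝ)) *
            (0.23 - ((τ₀.card : ℝ) * Real.log (p : ℝ) + 2) / (n : ℝ)))) := by
  have hC := Cmin_nonneg X τ₀ β₀
  set C := Cmin X τ₀ β₀ with hCdef
  have triv : ∀ r : ℝ, 1 ≤ r → jointMeasure n d
        {ω | ∀ b : Fin d, tauHat (X.mulVec β₀ + σ₀ • ω.1) (ω.2 b) ≠ τ₀} ≤ ENNReal.ofReal r := by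
    intro r hr
    refine prob_le_one.trans ?_
    rwa [ENNReal.one_le_ofReal]
  rcases Nat.eq_zero_or_pos n with hn | hn
  · apply triv
    have : (n : ℝ) = 0 := by exact_mod_cast hn
    simp only [this, zero_div, neg_zero, zero_mul, Real.exp_zero]
    norm_num
  rcases Nat.eq_zero_or_pos d with hd | hd
  · apply triv
    have : (d : ℝ) = 0 := by exact_mod_cast hd
    simp only [this, mul_zero, neg_zero, zero_mul, Real.exp_zero]
    have := Real.exp_pos (-((n : ℝ) / (18 * σ₀ ^ 2)) *
            (0.3 * C - 36 * (Real.log (p : ℝ) / (n : ℝ)) * σ₀ ^ 2))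
    linarith
  rcases Nat.eq_zero_or_pos p with hp | hp
  · subst hp
    have : {ω : (Fin n → ℝ) × (Fin d → Fin n → ℝ) |
        ∀ b : Fin d, tauHat (X.mulVec β₀ + σ₀ • ω.1) (ω.2 b) ≠ τ₀} = ∅ := by
      rw [Set.eq_empty_iff_forall_notMem]
      intro ω hω
      exact hω ⟨0, hd⟩ (Subsingleton.elim _ _)
    rw [this]
    simp
  have hn' : (0 : ℝ) < n := by exact_mod_cast hn
  have hp' : (0 : ℝ) < p := by exact_mod_cast hp
  have e1 : 6 * Real.exp (-((n : ℝ) / (18 * σ₀ ^ 2)) *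
            (0.3 * C - 36 * (Real.log (p : ℝ) / (n : ℝ)) * σ₀ ^ 2)) =
      6 * (p : ℝ) ^ 2 * Real.exp (-(n * C / σ₀ ^ 2) / 60) := by
    have h1 : (p : ℝ) ^ 2 = Real.exp (2 * Real.log p) := by
      rw [two_mul, Real.exp_add, Real.exp_log hp']; ring
    rw [h1, mul_assoc 6 (Real.exp _), ← Real.exp_add]
    congr 2
    field_simp
    ring
  have e2 : Real.exp (-((n : ℝ) * (d : ℝ)) *
            (0.23 - ((τ₀.card : ℝ) * Real.log (p : ℝ) + 2) / (n : ℝ))) =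
      Real.exp (-(0.23 * n) + τ₀.card * Real.log p + 2) ^ d := by
    rw [← Real.exp_nat_mul]
    congr 1
    field_simp
    ring
  rw [e1, e2]
  by_cases hsmall : 6 * (p : ℝ) ^ 2 * Real.exp (-(n * C / σ₀ ^ 2) / 60) ≤ 1
  swap
  · apply triv
    have : 0 < Real.exp (-(0.23 * n) + τ₀.card * Real.log p + 2) ^ d := by positivity
    linarith
  rw [ENNReal.ofReal_add (by positivity) (by positivity), ENNReal.ofReal_pow (by positivity)]
  have hNm := measurable_N X (X.mulVec β₀) σ₀ τ₀
  refine joint_bound {u | Good X τ₀ β₀ u} (measurable_Good X τ₀ β₀) _ hNm _ _ ?_ ?_ _ ?_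
  · intro u hu
    exact noise_all X τ₀ β₀ hβsupp σ₀ hσ₀ hn hp hGram hC hsmall u hu
  · exact bad_prob X τ₀ β₀ hp
  · intro ω hω b _
    exact ⟨tauHat (X.mulVec β₀ + σ₀ • ω.1) (ω.2 b), hω b, hcard _ _, hmin _ _ τ₀ le_rfl⟩

end ReproSamples
end
end

section
/- Suppose n − |τ₀| > 4 and let U ~ N(0, I_n) be a standard Gaussian vector. Then for any 0 < γ̃₁ < 1 and 0 < γ₂ < 1, the probability that U fails to lie in the set {u : max over models τ ≠ τ₀ with |τ| ≤ |τ₀| of ρ_{τ⊥}(u, X_{τ₀}β₀) < γ̃₁², and max over models τ ≠ τ₀ with |τ| ≤ |τ₀| of ρ(u, τ) < 1 − γ₂} is at most ℙ(max ρ_{τ⊥}(U, X_{τ₀}β₀) ≥ γ̃₁²) + ℙ(max ρ(U, τ) ≥ 1 − γ₂), which is at most 4·(arccos γ̃₁)^{n−|τ₀|−1}·p^{|τ₀|} + 2·γ₂^{(n−|τ₀|)/2 − 1}·(√n·p)^{|τ₀|}. -/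
open MeasureTheory ProbabilityTheory Matrix Filter
open scoped ENNReal Classical

noncomputable section

namespace ReproSamples

lemma gauss_sq_integral (a : ℝ) (ha : -1 < a) :
    ∫ x, Real.exp (-(a * x ^ 2) / 2) ∂(gaussianReal 0 1) = (√(1 + a))⁻¹ := by
  rw [integral_gaussianReal_eq_integral_smul (by simp)]
  have h : ∀ x : ℝ, gaussianPDFReal 0 1 x • Real.exp (-(a * x ^ 2) / 2)
      = (√(2 * Real.pi))⁻¹ * Real.exp (-((1 + a) / 2) * x ^ 2) := by
    intro x
    simp only [gaussianPDFReal, smul_eq_mul, NNReal.coe_one, mul_one, sub_zero]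
    rw [mul_assoc, ← Real.exp_add]
    congr 2
    ring
  simp_rw [h]
  rw [integral_const_mul, integral_gaussian, ← Real.sqrt_inv, ← Real.sqrt_inv, ← Real.sqrt_mul]
  · congr 1
    have : 1 + a ≠ 0 := by linarith
    have := Real.pi_ne_zero
    field_simp
  · positivity

lemma gauss_sq_integrable (a : ℝ) (ha : -1 < a) :
    Integrable (fun x => Real.exp (-(a * x ^ 2) / 2)) (gaussianReal 0 1) := by
  by_contra h
  have h1 := gauss_sq_integral a ha
  rw [integral_undef h] at h1
  have : 0 < (√(1 + a))⁻¹ := by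
    have : 0 < 1 + a := by linarith
    positivity
  linarith

lemma quad_lintegral {n : ℕ} (a : Fin n → ℝ) (ha : ∀ i, -1 < a i) :
    ∫⁻ x, ENNReal.ofReal (Real.exp (-(∑ i, a i * x i ^ 2) / 2)) ∂(stdGaussian n)
      = ENNReal.ofReal (∏ i, (√(1 + a i))⁻¹) := by
  have he : ∀ x : Fin n → ℝ, Real.exp (-(∑ i, a i * x i ^ 2) / 2) =
      ∏ i, (fun y : ℝ => Real.exp (-(a i * y ^ 2) / 2)) (x i) := by
    intro x
    rw [← Real.exp_sum]
    congr 1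
    rw [← Finset.sum_neg_distrib, Finset.sum_div]
  simp_rw [he]
  unfold stdGaussian
  rw [← ofReal_integral_eq_lintegral_ofReal]
  · rw [integral_fintype_prod_eq_prod (f := fun i (y : ℝ) => Real.exp (-(a i * y ^ 2) / 2))]
    simp_rw [fun i => gauss_sq_integral (a i) (ha i)]
  · exact Integrable.fintype_prod (f := fun i (y : ℝ) => Real.exp (-(a i * y ^ 2) / 2))
      (fun i => gauss_sq_integrable (a i) (ha i))
  · exact Filter.Eventually.of_forall fun x => Finset.prod_nonneg fun i _ => (Real.exp_pos _).le

lemma gauss_subG : HasSubgaussianMGF id 1 (gaussianReal 0 1) where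
  integrable_exp_mul t := integrable_exp_mul_gaussianReal t
  mgf_le t := by rw [mgf_id_gaussianReal]; simp

lemma gauss_subG' : HasSubgaussianMGF (fun x => -x) 1 (gaussianReal 0 1) := by
  simpa using! gauss_subG.neg

lemma gauss_tail (r : ℝ) (hr : 0 ≤ r) :
    gaussianReal 0 1 {z | r ≤ z ^ 2} ≤ ENNReal.ofReal (2 * Real.exp (-r / 2)) := by
  have hsub : {z : ℝ | r ≤ z ^ 2} ⊆ {z | √r ≤ id z} ∪ {z | √r ≤ -z} := by
    intro z hz
    have : √r ≤ |z| := by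
      rw [← Real.sqrt_sq_eq_abs]; exact Real.sqrt_le_sqrt hz
    rcases le_abs.1 this with h | h
    · exact Or.inl h
    · exact Or.inr h
  have h1 := gauss_subG.measure_ge_le (Real.sqrt_nonneg r)
  have h2 := gauss_subG'.measure_ge_le (Real.sqrt_nonneg r)
  have h3 : (gaussianReal 0 1).real {z : ℝ | r ≤ z ^ 2} ≤ 2 * Real.exp (-r / 2) := by
    refine (measureReal_mono hsub).trans ((measureReal_union_le _ _).trans ?_)
    simp only [NNReal.coe_one, mul_one, Real.sq_sqrt hr] at h1 h2
    linarith
  rw [← ofReal_measureReal]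
  exact ENNReal.ofReal_le_ofReal h3

lemma tail_one {n : ℕ} (i₀ : Fin n) (S : Finset (Fin n)) (hS : i₀ ∉ S) (c : ℝ) (hc : 0 ≤ c) :
    stdGaussian n {x | c * ∑ i ∈ S, x i ^ 2 ≤ x i₀ ^ 2} ≤
      ENNReal.ofReal (2 * (√(1 + c))⁻¹ ^ S.card) := by
  obtain _ | n := n
  · exact i₀.elim0
  let a : Fin n → ℝ := fun j => if i₀.succAbove j ∈ S then c else 0
  have hsum : ∀ x : Fin (n+1) → ℝ, c * ∑ i ∈ S, x i ^ 2 =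
      ∑ j, a j * x (i₀.succAbove j) ^ 2 := by
    intro x
    have : c * ∑ i ∈ S, x i ^ 2 = ∑ i, (if i ∈ S then c else 0) * x i ^ 2 := by
      simp [Finset.mul_sum, ite_mul]
    rw [this, Fin.sum_univ_succAbove _ i₀]
    simp [hS, a]
  have hprod : ∏ j, (√(1 + a j))⁻¹ = (√(1 + c))⁻¹ ^ S.card := by
    have : ∏ i, (√(1 + if i ∈ S then c else 0))⁻¹ = (√(1 + c))⁻¹ ^ S.card := by
      rw [← Finset.prod_const, ← Finset.prod_subset (Finset.subset_univ S)]
      · exact Finset.prod_congr rfl fun i hi => by simp [hi]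
      · intro i _ hi; simp [hi]
    rw [← this, Fin.prod_univ_succAbove _ i₀]
    simp [hS, a]
  have ha : ∀ j, 0 ≤ a j := by intro j; simp only [a]; split_ifs <;> simp [hc]
  let T : Set (ℝ × (Fin n → ℝ)) := {q | ∑ j, a j * q.2 j ^ 2 ≤ q.1 ^ 2}
  have hT : MeasurableSet T := measurableSet_le (by fun_prop) (by fun_prop)
  have hmp := measurePreserving_piFinSuccAbove (fun _ : Fin (n+1) => gaussianReal 0 1) i₀
  have hset : {x : Fin (n+1) → ℝ | c * ∑ i ∈ S, x i ^ 2 ≤ x i₀ ^ 2} =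
      (MeasurableEquiv.piFinSuccAbove (fun _ => ℝ) i₀) ⁻¹' T := by
    ext x
    simp [T, hsum, MeasurableEquiv.piFinSuccAbove, Fin.insertNthEquiv, Fin.removeNth]
  unfold stdGaussian
  rw [hset, hmp.measure_preimage hT.nullMeasurableSet, Measure.prod_apply_symm hT]
  calc _ ≤ ∫⁻ y, ENNReal.ofReal 2 * ENNReal.ofReal (Real.exp (-(∑ i, a i * y i ^ 2) / 2)) ∂(stdGaussian n) := by
        refine lintegral_mono fun y => ?_
        rw [← ENNReal.ofReal_mul (by norm_num)]
        exact gauss_tail _ (Finset.sum_nonneg fun i _ => mul_nonneg (ha i) (sq_nonneg _))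
    _ = _ := by
        rw [lintegral_const_mul _ (by fun_prop), quad_lintegral a (fun i => by linarith [ha i]),
          hprod, ← ENNReal.ofReal_mul (by norm_num)]

lemma chernoff {n : ℕ} (a : Fin n → ℝ) (ha : ∀ i, -1 < a i) :
    stdGaussian n {x | ∑ i, a i * x i ^ 2 ≤ 0} ≤ ENNReal.ofReal (∏ i, (√(1 + a i))⁻¹) := by
  rw [← quad_lintegral a ha]
  have hm : MeasurableSet {x : Fin n → ℝ | ∑ i, a i * x i ^ 2 ≤ 0} :=
    measurableSet_le (by fun_prop) (by fun_prop)
  rw [← lintegral_indicator_one hm]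
  refine lintegral_mono fun x => ?_
  by_cases hx : ∑ i, a i * x i ^ 2 ≤ 0
  · rw [Set.indicator_of_mem (by exact hx)]
    rw [Pi.one_apply, ENNReal.one_le_ofReal]
    exact Real.one_le_exp (by linarith)
  · rw [Set.indicator_of_notMem (by exact hx)]
    simp

lemma exists_basis {n : ℕ} (W : Submodule ℝ (EuclideanSpace ℝ (Fin n)))
    (e : EuclideanSpace ℝ (Fin n)) (he : e ∈ W) (hne : ‖e‖ = 1) :
    ∃ (b : OrthonormalBasis (Fin n) ℝ (EuclideanSpace ℝ (Fin n))) (D : Finset (Fin n))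
      (i₀ : Fin n), i₀ ∈ D ∧ b i₀ = e ∧ Module.finrank ℝ W ≤ D.card ∧
      (∀ i ∈ D, b i ∈ W) ∧ (∀ i ∉ D, b i ∈ Wᗮ) := by
  have h1 : Orthonormal ℝ ((↑) : ({(⟨e, he⟩ : W)} : Set W) → W) := by
    constructor
    · rintro ⟨x, hx⟩
      rw [Set.mem_singleton_iff] at hx
      subst hx
      simpa using hne
    · rintro ⟨x, hx⟩ ⟨y, hy⟩ hxy
      exfalso; apply hxy
      rw [Set.mem_singleton_iff] at hx hy
      subst hx; subst hy; rfl
  obtain ⟨u, bW, hu, hbW⟩ := h1.exists_orthonormalBasis_extension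
  have h2 : Orthonormal ℝ ((↑) : ((Subtype.val '' (u : Set W)) : Set (EuclideanSpace ℝ (Fin n))) → EuclideanSpace ℝ (Fin n)) := by
    have h3 : Orthonormal ℝ (fun x : u => ((x : W) : EuclideanSpace ℝ (Fin n))) := by
      have := bW.orthonormal.comp_linearIsometry W.subtypeₗᵢ
      rw [hbW] at this
      exact this
    have h4 : Set.range (fun x : u => ((x : W) : EuclideanSpace ℝ (Fin n))) = Subtype.val '' (u : Set W) := by
      ext y; simp
    rw [← h4, orthonormal_subtype_range]
    · exact h3
    · intro x y hxy
      exact Subtype.ext (Subtype.ext hxy)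
  obtain ⟨u', b', hu', hb'⟩ := h2.exists_orthonormalBasis_extension
  have hcard : Fintype.card u' = Fintype.card (Fin n) := by
    rw [← Module.finrank_eq_card_basis b'.toBasis]; simp
  let eq : u' ≃ Fin n := Fintype.equivOfCardEq hcard
  let b := b'.reindex eq
  have hb : ∀ x : u', b (eq x) = x := by
    intro x; simp [b, hb']
  have hmem : ∀ x ∈ u, (x : EuclideanSpace ℝ (Fin n)) ∈ u' := fun x hx => hu' ⟨x, hx, rfl⟩
  have heu : (⟨e, he⟩ : W) ∈ u := hu rfl
  let D : Finset (Fin n) := Finset.univ.filter fun i => b i ∈ W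
  refine ⟨b, D, eq ⟨e, hmem _ heu⟩, ?_, hb _, ?_, ?_, ?_⟩
  · simp [D, hb, he]
  · rw [Module.finrank_eq_card_basis bW.toBasis, ← Fintype.card_coe D]
    refine Fintype.card_le_of_injective
      (fun x : u => (⟨eq ⟨x, hmem _ x.2⟩, by simp [D, hb]⟩ : D)) ?_
    intro x y hxy
    simp only [Subtype.mk.injEq, EmbeddingLike.apply_eq_iff_eq] at hxy
    exact Subtype.ext (Subtype.ext hxy)
  · intro i hi; simpa [D] using hi
  · intro i hi
    have hi' : b i ∉ W := by simpa [D] using hi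
    rw [Submodule.mem_orthogonal]
    intro w hw
    have h5 : (⟨w, hw⟩ : W) = ∑ j, bW.repr ⟨w, hw⟩ j • bW j := (bW.sum_repr _).symm
    have h6 : w = ∑ j : u, bW.repr ⟨w, hw⟩ j • ((j : W) : EuclideanSpace ℝ (Fin n)) := by
      have := congrArg (W.subtype) h5
      rw [map_sum] at this
      simpa [hbW] using this
    rw [h6, sum_inner]
    refine Finset.sum_eq_zero fun j _ => ?_
    rw [inner_smul_left]
    have h7 : ((j : W) : EuclideanSpace ℝ (Fin n)) = b (eq ⟨j, hmem _ j.2⟩) := (hb ⟨j, hmem _ j.2⟩).symm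
    have h8 : eq ⟨j, hmem _ j.2⟩ ≠ i := by
      intro h
      apply hi'
      rw [← h, hb]
      exact j.1.2
    rw [h7, b.inner_eq_zero h8, mul_zero]

/-- Coordinates in an orthonormal basis. -/
def coordT {n : ℕ} (b : OrthonormalBasis (Fin n) ℝ (EuclideanSpace ℝ (Fin n)))
    (u : Fin n → ℝ) : Fin n → ℝ := fun i => inner ℝ (b i) (WithLp.toLp 2 u)

lemma coordT_mp {n : ℕ} (b : OrthonormalBasis (Fin n) ℝ (EuclideanSpace ℝ (Fin n))) :
    MeasurePreserving (coordT b) (stdGaussian n) (stdGaussian n) := by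
  have hm : Measurable (coordT b) := by
    unfold coordT
    fun_prop
  refine ⟨hm, ?_⟩
  have h1 : (stdGaussian n).map (WithLp.toLp 2) =
      ProbabilityTheory.stdGaussian (EuclideanSpace ℝ (Fin n)) := map_pi_eq_stdGaussian
  have h2 := stdGaussian_eq_map_pi_orthonormalBasis b
  have h3 : (stdGaussian n).map (coordT b) = ((stdGaussian n).map (WithLp.toLp 2)).map
      (fun v i => inner ℝ (b i) v) := by
    rw [Measure.map_map (by fun_prop) (by fun_prop)]
    rfl
  rw [h3, h1, h2, Measure.map_map (by fun_prop) (by fun_prop)]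
  have h4 : ((fun (v : EuclideanSpace ℝ (Fin n)) (i : Fin n) => inner ℝ (b i) v) ∘
      fun x : Fin n → ℝ => ∑ i, x i • b i) = id := by
    funext x
    funext i
    simp [inner_sum, inner_smul_right, b.inner_eq_ite]
  rw [h4, Measure.map_id]
  rfl

lemma coordT_sq {n : ℕ} (b : OrthonormalBasis (Fin n) ℝ (EuclideanSpace ℝ (Fin n)))
    (u : Fin n → ℝ) : sqnorm u = ∑ i, coordT b u i ^ 2 := by
  unfold coordT sqnorm
  rw [b.sum_sq_inner_right, EuclideanSpace.real_norm_sq_eq]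

/-- The kernel of `X_τᵀ`. -/
def kerW {n p : ℕ} (X : Matrix (Fin n) (Fin p) ℝ) (τ : Finset (Fin p)) :
    Submodule ℝ (EuclideanSpace ℝ (Fin n)) :=
  LinearMap.ker ((Matrix.mulVecLin (subcols X τ)ᵀ) ∘ₗ
    (WithLp.linearEquiv 2 ℝ (Fin n → ℝ)).toLinearMap)

lemma mem_kerW {n p : ℕ} (X : Matrix (Fin n) (Fin p) ℝ) (τ : Finset (Fin p)) (u : Fin n → ℝ) :
    WithLp.toLp 2 u ∈ kerW X τ ↔ (subcols X τ)ᵀ *ᵥ u = 0 := by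
  rw [Matrix.mulVec_transpose]
  simp [kerW]

lemma finrank_kerW {n p : ℕ} (X : Matrix (Fin n) (Fin p) ℝ) (τ : Finset (Fin p)) :
    n ≤ Module.finrank ℝ (kerW X τ) + τ.card := by
  let L : EuclideanSpace ℝ (Fin n) →ₗ[ℝ] ({j // j ∈ τ} → ℝ) :=
    (Matrix.mulVecLin (subcols X τ)ᵀ) ∘ₗ (WithLp.linearEquiv 2 ℝ (Fin n → ℝ)).toLinearMap
  have h : Module.finrank ℝ (LinearMap.range L) + Module.finrank ℝ (kerW X τ) =
      Module.finrank ℝ (EuclideanSpace ℝ (Fin n)) := LinearMap.finrank_range_add_finrank_ker L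
  have h2 : Module.finrank ℝ (LinearMap.range L) ≤ τ.card := by
    refine (Submodule.finrank_le _).trans ?_
    simp
  rw [finrank_euclideanSpace_fin] at h
  omega

lemma proj_sub_mem {n p : ℕ} (X : Matrix (Fin n) (Fin p) ℝ) (τ : Finset (Fin p))
    (hG : IsUnit ((subcols X τ)ᵀ * subcols X τ).det) (u : Fin n → ℝ) :
    WithLp.toLp 2 ((1 - proj X τ).mulVec u) ∈ kerW X τ := by
  rw [mem_kerW, Matrix.mulVec_mulVec, Matrix.mul_sub]
  have : (subcols X τ)ᵀ * proj X τ = (subcols X τ)ᵀ := by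
    unfold proj projMat
    rw [← Matrix.mul_assoc, ← Matrix.mul_assoc, Matrix.mul_nonsing_inv _ hG, Matrix.one_mul]
  rw [this]
  simp

lemma proj_mem_orth {n p : ℕ} (X : Matrix (Fin n) (Fin p) ℝ) (τ : Finset (Fin p))
    (u : Fin n → ℝ) : WithLp.toLp 2 ((proj X τ).mulVec u) ∈ (kerW X τ)ᗮ := by
  rw [Submodule.mem_orthogonal]
  intro w hw
  have hw' := (mem_kerW X τ (WithLp.ofLp w)).1 hw
  have h1 : inner ℝ w (WithLp.toLp 2 ((proj X τ).mulVec u)) =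
      WithLp.ofLp w ⬝ᵥ (proj X τ).mulVec u := by
    simp [PiLp.inner_apply, dotProduct, mul_comm]
  rw [h1]
  unfold proj projMat
  rw [Matrix.mul_assoc, ← Matrix.mulVec_mulVec, Matrix.dotProduct_mulVec,
    ← Matrix.mulVec_transpose, hw', zero_dotProduct]

lemma coord_facts {n p : ℕ} (X : Matrix (Fin n) (Fin p) ℝ) (τ : Finset (Fin p))
    (hG : IsUnit ((subcols X τ)ᵀ * subcols X τ).det)
    (b : OrthonormalBasis (Fin n) ℝ (EuclideanSpace ℝ (Fin n))) (D : Finset (Fin n))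
    (h1 : ∀ i ∈ D, b i ∈ kerW X τ) (h2 : ∀ i ∉ D, b i ∈ (kerW X τ)ᗮ) (u : Fin n → ℝ) :
    sqnorm ((1 - proj X τ).mulVec u) = ∑ i ∈ D, coordT b u i ^ 2 ∧
    sqnorm ((proj X τ).mulVec u) = ∑ i ∈ Dᶜ, coordT b u i ^ 2 ∧
    ∀ i ∈ D, coordT b ((1 - proj X τ).mulVec u) i = coordT b u i := by
  have hadd : ∀ i, coordT b u i = coordT b ((1 - proj X τ).mulVec u) i +
      coordT b ((proj X τ).mulVec u) i := by
    intro i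
    unfold coordT
    rw [← inner_add_right, ← WithLp.toLp_add, ← Matrix.add_mulVec]
    simp
  have hD : ∀ i ∈ D, coordT b ((proj X τ).mulVec u) i = 0 := fun i hi =>
    (Submodule.mem_orthogonal _ _).1 (proj_mem_orth X τ u) _ (h1 i hi)
  have hDc : ∀ i ∉ D, coordT b ((1 - proj X τ).mulVec u) i = 0 := fun i hi => by
    have := (Submodule.mem_orthogonal _ _).1 (h2 i hi) _ (proj_sub_mem X τ hG u)
    rw [real_inner_comm] at this
    exact this
  refine ⟨?_, ?_, fun i hi => by rw [hadd i, hD i hi, add_zero]⟩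
  · rw [coordT_sq b, ← Finset.sum_subset (Finset.subset_univ D)]
    · refine Finset.sum_congr rfl fun i hi => ?_
      rw [hadd i, hD i hi, add_zero]
    · intro i _ hi
      rw [hDc i hi]; simp
  · rw [coordT_sq b, ← Finset.sum_subset (Finset.subset_univ Dᶜ)]
    · refine Finset.sum_congr rfl fun i hi => ?_
      rw [hadd i, hDc i (Finset.mem_compl.1 hi), zero_add]
    · intro i _ hi
      rw [hD i (by simpa using hi)]; simp

lemma count_models {p : ℕ} (τ₀ : Finset (Fin p)) :
    (Finset.univ.filter fun τ : Finset (Fin p) => τ ≠ τ₀ ∧ τ.card ≤ τ₀.card).card ≤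
      p ^ τ₀.card := by
  set k := τ₀.card with hk
  let F : Finset (Finset (Fin p)) := Finset.univ.filter fun τ => τ.card ≤ k
  have h1 : (Finset.univ.filter fun τ : Finset (Fin p) => τ ≠ τ₀ ∧ τ.card ≤ k) = F.erase τ₀ := by
    ext τ; simp [F]
  have hmem : τ₀ ∈ F := by simp [F, hk]
  have h2 : F ⊆ insert ∅ ((Finset.univ : Finset (Fin k → Fin p)).image
      fun f => Finset.univ.image f) := by
    intro τ hτ
    rcases τ.eq_empty_or_nonempty with h | ⟨x, hx⟩
    · simp [h]
    · refine Finset.mem_insert_of_mem (Finset.mem_image.2 ?_)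
      have hτ' : τ.card ≤ k := by simpa [F] using hτ
      refine ⟨fun i => if h : i.1 < τ.card then (τ.equivFin.symm ⟨i.1, h⟩).1 else x,
        Finset.mem_univ _, ?_⟩
      ext y
      simp only [Finset.mem_image, Finset.mem_univ, true_and]
      constructor
      · rintro ⟨i, rfl⟩
        split_ifs
        · exact Subtype.prop _
        · exact hx
      · intro hy
        refine ⟨⟨(τ.equivFin ⟨y, hy⟩).1, lt_of_lt_of_le (Fin.is_lt _) hτ'⟩, ?_⟩
        simp
  have h3 : F.card ≤ p ^ k + 1 := by
    refine (Finset.card_le_card h2).trans ((Finset.card_insert_le _ _).trans ?_)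
    have : ((Finset.univ : Finset (Fin k → Fin p)).image
      fun f => Finset.univ.image f).card ≤ p ^ k := by
      refine Finset.card_image_le.trans ?_
      simp
    omega
  rw [h1, Finset.card_erase_of_mem hmem]
  omega

lemma union_models {n p : ℕ} (τ₀ : Finset (Fin p)) (P : Finset (Fin p) → (Fin n → ℝ) → Prop)
    (B : ℝ) (hB : 0 ≤ B)
    (h : ∀ τ : Finset (Fin p), τ ≠ τ₀ → τ.card ≤ τ₀.card →
      stdGaussian n {u | P τ u} ≤ ENNReal.ofReal B) :
    stdGaussian n {u | ∃ τ : Finset (Fin p), τ ≠ τ₀ ∧ τ.card ≤ τ₀.card ∧ P τ u} ≤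
      ENNReal.ofReal (B * (p : ℝ) ^ τ₀.card) := by
  let F := Finset.univ.filter fun τ : Finset (Fin p) => τ ≠ τ₀ ∧ τ.card ≤ τ₀.card
  have h1 : {u | ∃ τ : Finset (Fin p), τ ≠ τ₀ ∧ τ.card ≤ τ₀.card ∧ P τ u} =
      ⋃ τ ∈ F, {u | P τ u} := by
    ext u; simp [F, and_assoc]
  rw [h1]
  calc _ ≤ ∑ τ ∈ F, stdGaussian n {u | P τ u} := measure_biUnion_finset_le _ _
    _ ≤ ∑ τ ∈ F, ENNReal.ofReal B := Finset.sum_le_sum fun τ hτ => by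
        have := (Finset.mem_filter.1 hτ).2
        exact h τ this.1 this.2
    _ = ENNReal.ofReal (F.card * B) := by
        rw [Finset.sum_const, nsmul_eq_mul, ENNReal.ofReal_mul (by positivity)]
        simp
    _ ≤ _ := by
        apply ENNReal.ofReal_le_ofReal
        rw [mul_comm]
        refine mul_le_mul_of_nonneg_left ?_ hB
        exact_mod_cast count_models τ₀

lemma case_one {n p k : ℕ} (X : Matrix (Fin n) (Fin p) ℝ) (τ : Finset (Fin p))
    (hG : IsUnit ((subcols X τ)ᵀ * subcols X τ).det) (hk : τ.card ≤ k)
    (g : ℝ) (hg0 : 0 < g) (hg1 : g < 1) (w : Fin n → ℝ) :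
    stdGaussian n {u | g ^ 2 ≤ rhoPerp X τ u w} ≤
      ENNReal.ofReal (4 * Real.arccos g ^ (n - k - 1)) := by
  have hg2 : 0 < g ^ 2 := by positivity
  have hg3 : g ^ 2 < 1 := by nlinarith
  set w' := (1 - proj X τ).mulVec w with hw'
  have hs0 : 0 ≤ sqnorm w' := Finset.sum_nonneg fun i _ => sq_nonneg _
  rcases hs0.eq_or_lt with hs | hs
  · have : {u | g ^ 2 ≤ rhoPerp X τ u w} = ∅ := by
      ext u
      simp only [Set.mem_setOf_eq, Set.mem_empty_iff_false, iff_false, not_le]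
      unfold rhoPerp rho
      rw [← hw', ← hs]
      simpa using hg2
    rw [this]; simp
  set r := √(sqnorm w') with hr
  have hr0 : 0 < r := Real.sqrt_pos.2 hs
  have hr2 : r ^ 2 = sqnorm w' := Real.sq_sqrt hs0
  let e : EuclideanSpace ℝ (Fin n) := r⁻¹ • WithLp.toLp 2 w'
  have heW : e ∈ kerW X τ := Submodule.smul_mem _ _ (proj_sub_mem X τ hG w)
  have hnw : ‖(WithLp.toLp 2 w' : EuclideanSpace ℝ (Fin n))‖ = r := by
    rw [EuclideanSpace.norm_eq, hr]
    simp [sqnorm]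
  have hen : ‖e‖ = 1 := by
    rw [norm_smul, hnw, norm_inv, Real.norm_eq_abs, abs_of_pos hr0]
    exact inv_mul_cancel₀ hr0.ne'
  obtain ⟨b, D, i₀, hi₀, hb, hfr, h1, h2⟩ := exists_basis (kerW X τ) e heW hen
  have hDc : n - k - 1 ≤ (D.erase i₀).card := by
    rw [Finset.card_erase_of_mem hi₀]
    have := finrank_kerW X τ
    omega
  set c := g ^ 2 / (1 - g ^ 2) with hc
  have h1g : 0 < 1 - g ^ 2 := by linarith
  have hc0 : 0 ≤ c := by positivity
  have hsub : {u | g ^ 2 ≤ rhoPerp X τ u w} ⊆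
      coordT b ⁻¹' {x | c * ∑ i ∈ D.erase i₀, x i ^ 2 ≤ x i₀ ^ 2} := by
    intro u hu
    simp only [Set.mem_setOf_eq, Set.mem_preimage] at hu ⊢
    obtain ⟨hA, -, hC⟩ := coord_facts X τ hG b D h1 h2 u
    unfold rhoPerp rho at hu
    rw [← hw', hA] at hu
    have hdot : ((1 - proj X τ).mulVec u) ⬝ᵥ w' = r * coordT b u i₀ := by
      rw [← hC i₀ hi₀]
      unfold coordT
      rw [hb]
      simp only [e]
      rw [real_inner_smul_left, ← mul_assoc, mul_inv_cancel₀ hr0.ne', one_mul]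
      simp [PiLp.inner_apply, dotProduct, mul_comm]
    rw [hdot, mul_pow, hr2] at hu
    have hsum : ∑ i ∈ D, coordT b u i ^ 2 =
        coordT b u i₀ ^ 2 + ∑ i ∈ D.erase i₀, coordT b u i ^ 2 :=
      (Finset.add_sum_erase D (fun i => coordT b u i ^ 2) hi₀).symm
    have hD0 : 0 ≤ ∑ i ∈ D, coordT b u i ^ 2 := Finset.sum_nonneg fun i _ => sq_nonneg _
    have hD1 : 0 < ∑ i ∈ D, coordT b u i ^ 2 := by
      rcases hD0.eq_or_lt with h | h
      · rw [← h] at hu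
        simp at hu
        nlinarith
      · exact h
    rw [mul_comm (sqnorm w'), mul_div_mul_right _ _ hs.ne', le_div_iff₀ hD1, hsum] at hu
    rw [hc, div_mul_eq_mul_div, div_le_iff₀ h1g]
    nlinarith
  have hmeas : MeasurableSet {x : Fin n → ℝ | c * ∑ i ∈ D.erase i₀, x i ^ 2 ≤ x i₀ ^ 2} :=
    measurableSet_le (by fun_prop) (by fun_prop)
  refine (measure_mono hsub).trans ?_
  rw [(coordT_mp b).measure_preimage hmeas.nullMeasurableSet]
  refine (tail_one i₀ _ (Finset.notMem_erase _ _) c hc0).trans ?_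
  apply ENNReal.ofReal_le_ofReal
  have h1c : (√(1 + c))⁻¹ = √(1 - g ^ 2) := by
    rw [← Real.sqrt_inv]
    congr 1
    rw [hc]; field_simp; ring
  rw [h1c, ← Real.sin_arccos]
  have hθ0 : 0 ≤ Real.arccos g := Real.arccos_nonneg g
  have hs1 : Real.sin (Real.arccos g) ≤ Real.arccos g := Real.sin_le hθ0
  have hs2 : 0 ≤ Real.sin (Real.arccos g) := by rw [Real.sin_arccos]; positivity
  have h3 := pow_le_pow_of_le_one hs2 (Real.sin_le_one _) hDc
  have h4 := pow_le_pow_left₀ hs2 hs1 (n - k - 1)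
  have h5 : 0 ≤ Real.arccos g ^ (n - k - 1) := by positivity
  linarith

lemma exp_le_pow (d : ℕ) (hd : 1 ≤ d) : Real.exp d ≤ 4 * (d : ℝ) ^ d := by
  have he := Real.exp_one_lt_d9
  have h0 := Real.exp_pos 1
  have h1 : Real.exp d = Real.exp 1 ^ d := by rw [← Real.exp_nat_mul]; simp
  rw [h1]
  rcases Nat.lt_or_ge d 3 with h | h
  · interval_cases d
    · norm_num; linarith
    · have : Real.exp 1 ^ 2 ≤ 16 := by nlinarith
      refine this.trans ?_
      norm_num
  · have h3 : (3 : ℝ) ≤ d := by exact_mod_cast h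
    have : Real.exp 1 ^ d ≤ (d : ℝ) ^ d := pow_le_pow_left₀ h0.le (by linarith) d
    have : 0 ≤ (d : ℝ) ^ d := by positivity
    linarith

lemma ratio_pow (m d : ℕ) (hm : 0 < m) :
    (((m + d : ℕ) : ℝ) / m) ^ m ≤ Real.exp d := by
  have hm' : (0 : ℝ) < m := by exact_mod_cast hm
  have h1 : ((m + d : ℕ) : ℝ) / m = (d : ℝ) / m + 1 := by
    push_cast; field_simp; ring
  rw [h1]
  refine (pow_le_pow_left₀ (by positivity) (Real.add_one_le_exp _) m).trans ?_
  rw [← Real.exp_nat_mul]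
  apply le_of_eq
  congr 1
  field_simp

lemma case_two_core {n m d : ℕ} (hnmd : n = m + d) (hm : 0 < m) (hd : 1 ≤ d) (hn : 4 < n)
    (γ : ℝ) (h0 : 0 < γ) (h1 : γ < 1) (D : Finset (Fin n)) (hD : D.card = m)
    (hDc : Dᶜ.card = d) :
    stdGaussian n {x | (1 - γ) * ∑ i ∈ D, x i ^ 2 ≤ γ * ∑ i ∈ Dᶜ, x i ^ 2} ≤
      ENNReal.ofReal (2 * √γ ^ m * √n ^ d) := by
  have hm' : (0 : ℝ) < m := by exact_mod_cast hm
  have hd' : (0 : ℝ) < d := by exact_mod_cast hd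
  have hn' : (4 : ℝ) < n := by exact_mod_cast hn
  have hn0 : (0 : ℝ) < n := by linarith
  have hnr : (n : ℝ) = m + d := by exact_mod_cast hnmd
  have hrat : ((n : ℝ) / m) ^ m ≤ Real.exp d := by rw [hnmd]; exact ratio_pow m d hm
  have hγ' : 0 < 1 - γ := by linarith
  rcases le_or_gt ((m : ℝ) / n) γ with hcase | hcase
  · have hp : stdGaussian n {x | (1 - γ) * ∑ i ∈ D, x i ^ 2 ≤ γ * ∑ i ∈ Dᶜ, x i ^ 2} ≤ 1 := by
      have : IsProbabilityMeasure (stdGaussian n) := by unfold stdGaussian; infer_instance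
      exact prob_le_one
    refine hp.trans ?_
    rw [ENNReal.one_le_ofReal]
    have e1 : ((m : ℝ) / n) ^ m ≤ γ ^ m := pow_le_pow_left₀ (by positivity) hcase m
    have e2 : ((m : ℝ) / n) ^ m * ((n : ℝ) / m) ^ m = 1 := by
      rw [← mul_pow]; field_simp; simp
    have e3 : Real.exp d ≤ (n : ℝ) ^ d := by
      have : Real.exp d = Real.exp 1 ^ d := by rw [← Real.exp_nat_mul]; simp
      rw [this]
      exact pow_le_pow_left₀ (Real.exp_pos 1).le (by linarith [Real.exp_one_lt_d9]) d
    have e4 : 1 ≤ γ ^ m * (n : ℝ) ^ d := by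
      rw [← e2]
      exact mul_le_mul e1 (hrat.trans e3) (by positivity) (by positivity)
    have e5 : 1 ≤ √γ ^ m * √n ^ d := by
      have : √γ ^ m * √n ^ d = √(γ ^ m * (n : ℝ) ^ d) := by
        rw [Real.sqrt_mul (by positivity), Real.sqrt_eq_rpow, Real.sqrt_eq_rpow,
          Real.sqrt_eq_rpow, Real.sqrt_eq_rpow, ← Real.rpow_natCast, ← Real.rpow_natCast,
          ← Real.rpow_natCast, ← Real.rpow_natCast, ← Real.rpow_mul (by positivity),
          ← Real.rpow_mul (by positivity), ← Real.rpow_mul (by positivity),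
          ← Real.rpow_mul (by positivity), mul_comm (m : ℝ), mul_comm (d : ℝ)]
      rw [this]
      exact Real.one_le_sqrt.2 e4
    linarith
  · set s := (m : ℝ) / (n * γ) - 1 with hs
    have hs0 : 0 < s := by
      rw [hs, sub_pos, lt_div_iff₀ (by positivity)]
      rw [lt_div_iff₀ hn0] at hcase
      linarith
    set c := γ / (1 - γ) with hc
    have hsc : 1 - s * c = ((d : ℝ) / n) / (1 - γ) := by
      rw [hs, hc]
      field_simp
      rw [hnr]; ring
    have hsc0 : 0 < 1 - s * c := by rw [hsc]; positivity
    let a : Fin n → ℝ := fun i => if i ∈ D then s else -(s * c)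
    have ha : ∀ i, -1 < a i := by
      intro i; simp only [a]; split_ifs <;> linarith
    have hsplit : ∀ x : Fin n → ℝ, ∑ i, a i * x i ^ 2 =
        s * (∑ i ∈ D, x i ^ 2) - s * c * ∑ i ∈ Dᶜ, x i ^ 2 := by
      intro x
      rw [← Finset.sum_add_sum_compl D, Finset.mul_sum, Finset.mul_sum, sub_eq_add_neg,
        ← Finset.sum_neg_distrib]
      congr 1
      · exact Finset.sum_congr rfl fun i hi => by simp [a, hi]
      · exact Finset.sum_congr rfl fun i hi => by simp [a, Finset.mem_compl.1 hi]
    have hprod : ∏ i, (√(1 + a i))⁻¹ = (√(1 + s))⁻¹ ^ m * (√(1 - s * c))⁻¹ ^ d := by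
      rw [← Finset.prod_mul_prod_compl D, ← hD, ← hDc, ← Finset.prod_const, ← Finset.prod_const]
      congr 1
      · exact Finset.prod_congr rfl fun i hi => by simp [a, hi]
      · exact Finset.prod_congr rfl fun i hi => by
          simp [a, Finset.mem_compl.1 hi, sub_eq_add_neg]
    have hsub : {x : Fin n → ℝ | (1 - γ) * ∑ i ∈ D, x i ^ 2 ≤ γ * ∑ i ∈ Dᶜ, x i ^ 2} ⊆
        {x | ∑ i, a i * x i ^ 2 ≤ 0} := by
      intro x hx
      simp only [Set.mem_setOf_eq] at hx ⊢
      rw [hsplit]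
      have : (∑ i ∈ D, x i ^ 2) ≤ c * ∑ i ∈ Dᶜ, x i ^ 2 := by
        rw [hc, div_mul_eq_mul_div, le_div_iff₀ hγ']
        linarith
      nlinarith
    refine (measure_mono hsub).trans ((chernoff a ha).trans ?_)
    apply ENNReal.ofReal_le_ofReal
    rw [hprod]
    refine (sq_le_sq₀ (by positivity) (by positivity)).1 ?_
    have q1 : ((√(1 + s))⁻¹ ^ m * (√(1 - s * c))⁻¹ ^ d) ^ 2 = (1 + s)⁻¹ ^ m * (1 - s * c)⁻¹ ^ d := by
      rw [mul_pow, ← pow_mul, ← pow_mul, mul_comm m, mul_comm d, pow_mul, pow_mul, inv_pow,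
        inv_pow (√(1 - s * c)), Real.sq_sqrt (by linarith), Real.sq_sqrt hsc0.le]
    have q2 : (2 * √γ ^ m * √n ^ d) ^ 2 = 4 * γ ^ m * (n : ℝ) ^ d := by
      rw [mul_pow, mul_pow, ← pow_mul, ← pow_mul, mul_comm m, mul_comm d, pow_mul (√γ),
        pow_mul (√(n : ℝ)), Real.sq_sqrt h0.le, Real.sq_sqrt hn0.le]
      norm_num
    rw [q1, q2]
    have q3 : (1 + s)⁻¹ = γ * ((n : ℝ) / m) := by
      have : 1 + s = (m : ℝ) / (n * γ) := by rw [hs]; ring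
      rw [this]; field_simp
    have q4 : (1 - s * c)⁻¹ = (n : ℝ) * ((1 - γ) / d) := by
      rw [hsc]; field_simp
    rw [q3, q4, mul_pow, mul_pow, div_pow (1 - γ)]
    have q5 : (1 - γ) ^ d ≤ 1 := pow_le_one₀ hγ'.le (by linarith)
    have q6 : ((n : ℝ) / m) ^ m * ((1 - γ) ^ d / (d : ℝ) ^ d) ≤ 4 := by
      rw [← mul_div_assoc, div_le_iff₀ (by positivity)]
      calc _ ≤ ((n : ℝ) / m) ^ m * 1 := mul_le_mul_of_nonneg_left q5 (by positivity)
        _ ≤ _ := by rw [mul_one]; exact hrat.trans (exp_le_pow d hd)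
    calc _ = γ ^ m * (n : ℝ) ^ d * (((n : ℝ) / m) ^ m * ((1 - γ) ^ d / (d : ℝ) ^ d)) := by ring
      _ ≤ γ ^ m * (n : ℝ) ^ d * 4 := mul_le_mul_of_nonneg_left q6 (by positivity)
      _ = _ := by ring

lemma case_two {n p k : ℕ} (X : Matrix (Fin n) (Fin p) ℝ) (τ : Finset (Fin p))
    (hG : IsUnit ((subcols X τ)ᵀ * subcols X τ).det) (hk : τ.card ≤ k) (hn : k + 4 < n)
    (γ : ℝ) (h0 : 0 < γ) (h1 : γ < 1) :
    stdGaussian n {u | 1 - γ ≤ rhoTau X u τ} ≤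
      ENNReal.ofReal (2 * γ ^ (((n : ℝ) - (k : ℝ)) / 2 - 1) * √(n : ℝ) ^ k) := by
  have hfr := finrank_kerW X τ
  have hpos : 0 < Module.finrank ℝ (kerW X τ) := by omega
  have : Nontrivial (kerW X τ) := Module.finrank_pos_iff.1 hpos
  obtain ⟨v, hv⟩ := exists_norm_eq (kerW X τ) (c := 1) (by norm_num)
  obtain ⟨b, D, i₀, hi₀, -, hfrD, hb1, hb2⟩ := exists_basis (kerW X τ) v v.2 (by simpa using hv)
  have hcc : D.card + Dᶜ.card = n := by simpa using Finset.card_add_card_compl D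
  have hsub : {u | 1 - γ ≤ rhoTau X u τ} ⊆
      {u | 1 ≤ Dᶜ.card ∧ (1 - γ) * ∑ i ∈ D, coordT b u i ^ 2 ≤ γ * ∑ i ∈ Dᶜ, coordT b u i ^ 2} := by
    intro u hu
    simp only [Set.mem_setOf_eq] at hu ⊢
    obtain ⟨-, hB, -⟩ := coord_facts X τ hG b D hb1 hb2 u
    unfold rhoTau at hu
    rw [hB, coordT_sq b, ← Finset.sum_add_sum_compl D] at hu
    have hA0 : 0 ≤ ∑ i ∈ D, coordT b u i ^ 2 := Finset.sum_nonneg fun i _ => sq_nonneg _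
    have hB0 : 0 ≤ ∑ i ∈ Dᶜ, coordT b u i ^ 2 := Finset.sum_nonneg fun i _ => sq_nonneg _
    constructor
    · by_contra hcon
      have : Dᶜ = ∅ := by rw [← Finset.card_eq_zero]; omega
      rw [this] at hu
      simp at hu
      linarith
    · rcases (add_nonneg hA0 hB0).eq_or_lt with h | h
      · rw [← h] at hu
        simp at hu
        linarith
      · rw [le_div_iff₀ h] at hu
        linarith
  refine (measure_mono hsub).trans ?_
  by_cases hd : 1 ≤ Dᶜ.card
  swap
  · simp [hd]
  simp only [hd, true_and]
  have hmeas : MeasurableSet {x : Fin n → ℝ |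
      (1 - γ) * ∑ i ∈ D, x i ^ 2 ≤ γ * ∑ i ∈ Dᶜ, x i ^ 2} :=
    measurableSet_le (by fun_prop) (by fun_prop)
  have hpre := (coordT_mp b).measure_preimage hmeas.nullMeasurableSet
  have hcore := case_two_core hcc.symm (Finset.card_pos.2 ⟨i₀, hi₀⟩) hd (by omega) γ h0 h1 D rfl rfl
  rw [← hpre] at hcore
  refine hcore.trans (ENNReal.ofReal_le_ofReal ?_)
  have hn1 : (1 : ℝ) ≤ √(n : ℝ) := by
    rw [Real.one_le_sqrt]; exact_mod_cast (by omega : 1 ≤ n)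
  have r1 : √(n : ℝ) ^ Dᶜ.card ≤ √(n : ℝ) ^ k := pow_le_pow_right₀ hn1 (by omega)
  have r2 : √γ ^ D.card ≤ γ ^ (((n : ℝ) - (k : ℝ)) / 2 - 1) := by
    rw [Real.sqrt_eq_rpow, ← Real.rpow_natCast, ← Real.rpow_mul h0.le]
    apply Real.rpow_le_rpow_of_exponent_ge h0 h1.le
    have : (n : ℝ) ≤ D.card + k := by exact_mod_cast (by omega : n ≤ D.card + k)
    linarith
  exact mul_le_mul (mul_le_mul_of_nonneg_left r2 (by norm_num)) r1 (by positivity) (by positivity)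

/-- **Lemma (good event for the true error).** For `U ~ N(0, I_n)` and
`n − |τ₀| > 4`, the probability that `U` fails the joint angle conditions is at
most the sum of the two tail probabilities, which is at most
`4 (arccos γtilde₁)^{n−|τ₀|−1} p^{|τ₀|} + 2 γ₂^{(n−|τ₀|)/2 − 1} (√n p)^{|τ₀|}`. -/
theorem good_event_probability_bound {n p : ℕ}
    (X : Matrix (Fin n) (Fin p) ℝ) (τ₀ : Finset (Fin p)) (β₀ : Fin p → ℝ)
    (hβsupp : ∀ j ∉ τ₀, β₀ j = 0) (hβne : ∀ j ∈ τ₀, β₀ j ≠ 0)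
    (hGram : ∀ τ : Finset (Fin p), τ.card ≤ τ₀.card →
      IsUnit ((subcols X τ)ᵀ * subcols X τ).det)
    (hn : τ₀.card + 4 < n)
    (γtilde₁ γ₂ : ℝ) (hγtilde₁ : γtilde₁ ∈ Set.Ioo (0 : ℝ) 1) (hγ₂ : γ₂ ∈ Set.Ioo (0 : ℝ) 1) :
    stdGaussian n
        {u | ¬ ((∀ τ : Finset (Fin p), τ ≠ τ₀ → τ.card ≤ τ₀.card →
            rhoPerp X τ u (X.mulVec β₀) < γtilde₁ ^ 2) ∧
          (∀ τ : Finset (Fin p), τ ≠ τ₀ → τ.card ≤ τ₀.card →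
            rhoTau X u τ < 1 - γ₂))} ≤
      stdGaussian n
          {u | ∃ τ : Finset (Fin p), τ ≠ τ₀ ∧ τ.card ≤ τ₀.card ∧
            γtilde₁ ^ 2 ≤ rhoPerp X τ u (X.mulVec β₀)} +
        stdGaussian n
          {u | ∃ τ : Finset (Fin p), τ ≠ τ₀ ∧ τ.card ≤ τ₀.card ∧
            1 - γ₂ ≤ rhoTau X u τ} ∧
    stdGaussian n
          {u | ∃ τ : Finset (Fin p), τ ≠ τ₀ ∧ τ.card ≤ τ₀.card ∧
            γtilde₁ ^ 2 ≤ rhoPerp X τ u (X.mulVec β₀)} +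
        stdGaussian n
          {u | ∃ τ : Finset (Fin p), τ ≠ τ₀ ∧ τ.card ≤ τ₀.card ∧
            1 - γ₂ ≤ rhoTau X u τ} ≤
      ENNReal.ofReal
        (4 * Real.arccos γtilde₁ ^ (n - τ₀.card - 1) * (p : ℝ) ^ τ₀.card +
          2 * γ₂ ^ (((n : ℝ) - (τ₀.card : ℝ)) / 2 - 1) *
            (Real.sqrt (n : ℝ) * (p : ℝ)) ^ τ₀.card) := by
  constructor
  · refine (measure_mono ?_).trans (measure_union_le _ _)
    intro u hu
    simp only [Set.mem_setOf_eq] at hu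
    by_cases h : ∀ τ : Finset (Fin p), τ ≠ τ₀ → τ.card ≤ τ₀.card →
        rhoPerp X τ u (X.mulVec β₀) < γtilde₁ ^ 2
    · right
      by_contra hcon
      apply hu
      refine ⟨h, fun τ h1 h2 => ?_⟩
      by_contra h3
      exact hcon ⟨τ, h1, h2, not_lt.1 h3⟩
    · left
      by_contra hcon
      apply h
      intro τ h1 h2
      by_contra h3
      exact hcon ⟨τ, h1, h2, not_lt.1 h3⟩
  · have hθ : 0 ≤ Real.arccos γtilde₁ := Real.arccos_nonneg _
    have hγ0 : 0 < γ₂ := hγ₂.1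
    have hA := union_models τ₀ (fun τ (u : Fin n → ℝ) => γtilde₁ ^ 2 ≤ rhoPerp X τ u (X.mulVec β₀))
      (4 * Real.arccos γtilde₁ ^ (n - τ₀.card - 1)) (by positivity)
      (fun τ _ hτ => case_one X τ (hGram τ hτ) hτ γtilde₁ hγtilde₁.1 hγtilde₁.2 _)
    have hB := union_models τ₀ (fun τ (u : Fin n → ℝ) => 1 - γ₂ ≤ rhoTau X u τ)
      (2 * γ₂ ^ (((n : ℝ) - (τ₀.card : ℝ)) / 2 - 1) * √(n : ℝ) ^ τ₀.card) (by positivity)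
      (fun τ _ hτ => case_two X τ (hGram τ hτ) hτ hn γ₂ hγ₂.1 hγ₂.2)
    rw [ENNReal.ofReal_add (by positivity) (by positivity)]
    refine add_le_add hA (hB.trans (le_of_eq ?_))
    rw [mul_pow, mul_assoc]

end ReproSamples
end
end
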